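/- arXiv:1503.00605 — 3 statements merged into one kernel-verified Lean document; each statement's English description precedes it below -/
import Mathlib

section
/- Every even triangulation of the torus is either properly vertex-3-colorable, or becomes properly vertex-3-colorable after being cut along a suitable simple closed curve. -/
/-!
Combinatorial triangulated surfaces.

A triangulation is encoded by its finset of faces (each a 3-element finset of
vertices).  `IsClosedSurface` says: nonempty, every face a triangle, every edge
in exactly two faces, and the faces around each vertex are connected through
edges containing that vertex (so the link of every vertex is a single cycle).
A connected closed surface with Euler characteristic 2 is a sphere, with
Euler characteristic 1 is the projective plane, and an orientable one with
Euler characteristic 0 is the torus.  Surfaces with boundary allow edges lying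
in exactly one face; a connected such surface is simply connected iff it is a
disk (Euler characteristic 1, with boundary) or a sphere (Euler characteristic 2).
The degree of a vertex is the number of edges containing it.
-/

namespace Fisk

variable {V : Type*} [DecidableEq V]

/-- The edges of a triangulation: the 2-element subsets of its faces. -/
def edges (F : Finset (Finset V)) : Finset (Finset V) :=
  F.biUnion (fun f => f.powersetCard 2)

/-- The vertex set of a triangulation. -/
def vertices (F : Finset (Finset V)) : Finset V := F.sup id

/-- The degree of a vertex: the number of edges containing it. -/
def degree (F : Finset (Finset V)) (v : V) : ℕ :=
  ((edges F).filter (fun e => v ∈ e)).card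

/-- Two vertices are adjacent if they span an edge. -/
def IsAdjacent (F : Finset (Finset V)) (a b : V) : Prop :=
  a ≠ b ∧ ({a, b} : Finset V) ∈ edges F

/-- The faces are connected under the relation "share an edge". -/
def FacesConnected (F : Finset (Finset V)) : Prop :=
  ∀ f ∈ F, ∀ g ∈ F,
    Relation.ReflTransGen (fun x y => x ∈ F ∧ y ∈ F ∧ (x ∩ y).card = 2) f g

/-- Around every vertex, the faces containing it are connected through
edges containing it (links are connected). -/
def LinkConnected (F : Finset (Finset V)) : Prop :=
  ∀ v : V, ∀ f ∈ F, ∀ g ∈ F, v ∈ f → v ∈ g →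
    Relation.ReflTransGen
      (fun x y => x ∈ F ∧ y ∈ F ∧ v ∈ x ∧ v ∈ y ∧ (x ∩ y).card = 2) f g

/-- A triangulation of a closed surface. -/
def IsClosedSurface (F : Finset (Finset V)) : Prop :=
  F.Nonempty ∧ (∀ f ∈ F, f.card = 3) ∧
  (∀ e ∈ edges F, (F.filter (fun f => e ⊆ f)).card = 2) ∧
  LinkConnected F

/-- The Euler characteristic `#V - #E + #F`. -/
def eulerChar (F : Finset (Finset V)) : ℤ :=
  ((vertices F).card : ℤ) - ((edges F).card : ℤ) + (F.card : ℤ)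

/-- A triangulation of the 2-sphere: a connected closed surface with
Euler characteristic 2. -/
def IsSphere (F : Finset (Finset V)) : Prop :=
  IsClosedSurface F ∧ FacesConnected F ∧ eulerChar F = 2

/-- The oriented edges of an ordered triple. -/
def orientedEdges (t : V × V × V) : Finset (V × V) :=
  {(t.1, t.2.1), (t.2.1, t.2.2), (t.2.2, t.1)}

/-- Orientability: each face can be given a cyclic order of its vertices so
that no directed edge is induced by two different faces (i.e. adjacent faces
induce opposite orientations on their common edge). -/
def Orientable (F : Finset (Finset V)) : Prop :=
  ∃ o : Finset V → V × V × V,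
    (∀ f ∈ F, ({(o f).1, (o f).2.1, (o f).2.2} : Finset V) = f) ∧
    (∀ f ∈ F, ∀ g ∈ F, f ≠ g → ∀ p ∈ orientedEdges (o f), p ∉ orientedEdges (o g))

/-- A triangulation of the torus: a connected orientable closed surface with
Euler characteristic 0. -/
def IsTorus (F : Finset (Finset V)) : Prop :=
  IsClosedSurface F ∧ FacesConnected F ∧ Orientable F ∧ eulerChar F = 0

/-- A triangulation of the projective plane: a connected closed surface with
Euler characteristic 1. -/
def IsProjectivePlane (F : Finset (Finset V)) : Prop :=
  IsClosedSurface F ∧ FacesConnected F ∧ eulerChar F = 1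

/-- A triangulation of a surface, possibly with boundary: every edge lies in
one or two faces. -/
def IsSurfaceWithBoundary (F : Finset (Finset V)) : Prop :=
  F.Nonempty ∧ (∀ f ∈ F, f.card = 3) ∧
  (∀ e ∈ edges F,
    (F.filter (fun f => e ⊆ f)).card = 1 ∨ (F.filter (fun f => e ⊆ f)).card = 2) ∧
  LinkConnected F

/-- The boundary edges: edges lying in exactly one face. -/
def boundaryEdges (F : Finset (Finset V)) : Finset (Finset V) :=
  (edges F).filter (fun e => (F.filter (fun f => e ⊆ f)).card = 1)

/-- The boundary vertices: vertices of boundary edges. -/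
def boundaryVertices (F : Finset (Finset V)) : Finset V :=
  (boundaryEdges F).sup id

/-- A compact connected surface (possibly with boundary) is simply connected
iff it is a sphere (χ = 2) or a disk (χ = 1, nonempty boundary). -/
def IsSimplyConnectedSurface (F : Finset (Finset V)) : Prop :=
  IsSurfaceWithBoundary F ∧ FacesConnected F ∧
    (eulerChar F = 2 ∨ (eulerChar F = 1 ∧ (boundaryEdges F).Nonempty))

/-- A triangulation of a disk (= of a polygon, the corners being the boundary
vertices): a connected surface with nonempty boundary and Euler characteristic 1. -/
def IsDisk (F : Finset (Finset V)) : Prop :=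
  IsSurfaceWithBoundary F ∧ FacesConnected F ∧ eulerChar F = 1 ∧
    (boundaryEdges F).Nonempty

/-- A proper vertex coloring: the two endpoints of every edge get distinct
colors (for a triangulation: every triangle receives all three colors). -/
def ProperColoring {C : Type*} (F : Finset (Finset V)) (c : V → C) : Prop :=
  ∀ e ∈ edges F, ∀ u ∈ e, ∀ w ∈ e, u ≠ w → c u ≠ c w

end Fisk

namespace Fisk

open SimpleGraph

/-- An orientation of the faces of a closed surface, recorded by the function sending an oriented
edge `(a, b)` to the third vertex of the face lying on the left of it. -/
structure OrientedTriangulation {V : Type*} [DecidableEq V] (F : Finset (Finset V)) where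
  closed : IsClosedSurface F
  /-- The 1-skeleton. -/
  G : SimpleGraph V
  /-- The third vertex of the face on the left of an oriented edge. -/
  nx : V → V → V
  adj_iff : ∀ a b, G.Adj a b ↔ IsAdjacent F a b
  adj_nx : ∀ {a b}, G.Adj a b → G.Adj b (nx a b)
  nx_nx : ∀ {a b}, G.Adj a b → nx b (nx a b) = a
  nx_ne : ∀ {a b}, G.Adj a b → nx a b ≠ nx b a
  mem_face : ∀ {a b}, G.Adj a b → ({a, b, nx a b} : Finset V) ∈ F
  eq_or : ∀ f ∈ F, ∀ a ∈ f, ∀ b ∈ f, a ≠ b →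
    f = ({a, b, nx a b} : Finset V) ∨ f = ({b, a, nx b a} : Finset V)

section

variable {V : Type*} [DecidableEq V] {F : Finset (Finset V)}

theorem pair_mem_edges_iff {a b : V} (hab : a ≠ b) :
    ({a, b} : Finset V) ∈ edges F ↔ ∃ f ∈ F, a ∈ f ∧ b ∈ f := by
  simp [edges, Finset.mem_powersetCard, Finset.insert_subset_iff, Finset.card_pair hab]

theorem IsAdjacent.symm {a b : V} (h : IsAdjacent F a b) : IsAdjacent F b a :=
  ⟨h.1.symm, by rw [Finset.pair_comm]; exact h.2⟩

theorem card_faces_of_pair (hF : IsClosedSurface F) {a b : V} (h : IsAdjacent F a b) :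
    (F.filter (fun f => a ∈ f ∧ b ∈ f)).card = 2 := by
  have := hF.2.2.1 _ h.2
  simpa [Finset.insert_subset_iff] using this

/-- Each oriented edge lies in the oriented boundary of some face. -/
theorem exists_left_face (hF : IsClosedSurface F) {o : Finset V → V × V × V}
    (ho : ∀ f ∈ F, ({(o f).1, (o f).2.1, (o f).2.2} : Finset V) = f)
    (ho' : ∀ f ∈ F, ∀ g ∈ F, f ≠ g → ∀ p ∈ orientedEdges (o f), p ∉ orientedEdges (o g))
    {a b : V} (h : IsAdjacent F a b) : ∃ f ∈ F, (a, b) ∈ orientedEdges (o f) := by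
  obtain ⟨f, g, hfg, hS⟩ := Finset.card_eq_two.1 (card_faces_of_pair hF h)
  have hf : f ∈ F.filter (fun f => a ∈ f ∧ b ∈ f) := by simp [hS]
  have hg : g ∈ F.filter (fun f => a ∈ f ∧ b ∈ f) := by simp [hS]
  rw [Finset.mem_filter] at hf hg
  have key : ∀ f ∈ F, a ∈ f → b ∈ f →
      (a, b) ∈ orientedEdges (o f) ∨ (b, a) ∈ orientedEdges (o f) := by
    intro f hf ha hb
    have hne := h.1
    rw [← ho f hf] at ha hb
    simp only [Finset.mem_insert, Finset.mem_singleton, orientedEdges, Prod.mk.injEq] at *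
    grind
  rcases key f hf.1 hf.2.1 hf.2.2 with h1 | h1
  · exact ⟨f, hf.1, h1⟩
  rcases key g hg.1 hg.2.1 hg.2.2 with h2 | h2
  · exact ⟨g, hg.1, h2⟩
  exact absurd h2 (ho' f hf.1 g hg.1 hfg _ h1)

theorem exists_third_of_oriented {o : Finset V → V × V × V}
    (ho : ∀ f ∈ F, ({(o f).1, (o f).2.1, (o f).2.2} : Finset V) = f)
    {f : Finset V} (hf : f ∈ F) {a b : V} (h : (a, b) ∈ orientedEdges (o f)) :
    ∃ c, f = {a, b, c} ∧ (b, c) ∈ orientedEdges (o f) ∧ (c, a) ∈ orientedEdges (o f) := by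
  have h1 := ho f hf
  simp only [Finset.mem_insert, Finset.mem_singleton, orientedEdges, Prod.mk.injEq] at *
  rcases h with h | h | h
  · exact ⟨(o f).2.2, by rw [h.1, h.2]; exact h1.symm, by grind, by grind⟩
  · exact ⟨(o f).1, by rw [h.1, h.2]; refine h1.symm.trans ?_; ext; simp; tauto, by grind, by grind⟩
  · refine ⟨(o f).2.1, ?_, by grind, by grind⟩
    rw [h.1, h.2]
    refine h1.symm.trans ?_
    ext
    simp
    tauto

theorem third_ne (hF : IsClosedSurface F) {a b c : V} (hf : ({a, b, c} : Finset V) ∈ F) :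
    a ≠ b ∧ b ≠ c ∧ c ≠ a := by
  have := hF.2.1 _ hf
  refine ⟨?_, ?_, ?_⟩ <;> rintro rfl
  · have h := Finset.card_le_two (a := a) (b := c); simp at this; omega
  · have h := Finset.card_le_two (a := a) (b := b); simp at this; omega
  · have h := Finset.card_le_two (a := b) (b := c)
    rw [Finset.insert_eq_of_mem (by simp)] at this; omega

theorem exists_orientedTriangulation (hF : IsClosedSurface F) (ho : Orientable F) :
    Nonempty (OrientedTriangulation F) := by
  classical
  obtain ⟨o, ho, ho'⟩ := ho
  have h0 : ∀ a b, ∃ c, IsAdjacent F a b → ∃ f ∈ F, f = {a, b, c} ∧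
      (a, b) ∈ orientedEdges (o f) ∧
      (b, c) ∈ orientedEdges (o f) ∧ (c, a) ∈ orientedEdges (o f) := by
    intro a b
    by_cases h : IsAdjacent F a b
    · obtain ⟨f, hf, hab⟩ := exists_left_face hF ho ho' h
      obtain ⟨c, hc⟩ := exists_third_of_oriented ho hf hab
      exact ⟨c, fun _ => ⟨f, hf, hc.1, hab, hc.2⟩⟩
    · exact ⟨a, fun h' => absurd h' h⟩
  choose nx hnx using h0
  have uniq : ∀ f ∈ F, ∀ g ∈ F, ∀ p, p ∈ orientedEdges (o f) → p ∈ orientedEdges (o g) →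
      f = g := by
    intro f hf g hg p hp hq
    by_contra hne
    exact ho' f hf g hg hne p hp hq
  have mem : ∀ {a b}, IsAdjacent F a b → ({a, b, nx a b} : Finset V) ∈ F := by
    intro a b h
    obtain ⟨f, hf, rfl, -⟩ := hnx a b h
    exact hf
  have adj : ∀ {a b}, IsAdjacent F a b → IsAdjacent F b (nx a b) := by
    intro a b h
    have h2 := (third_ne hF (mem h)).2.1
    exact ⟨h2, (pair_mem_edges_iff h2).2 ⟨_, mem h, by simp, by simp⟩⟩
  have third : ∀ {a b c : V}, ({a, b, c} : Finset V) ∈ F →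
      ∀ {d}, ({a, b, c} : Finset V) = {a, b, d} → c = d := by
    intro a b c h d hd
    have h3 := third_ne hF h
    have : c ∈ ({a, b, d} : Finset V) := by rw [← hd]; simp
    simp only [Finset.mem_insert, Finset.mem_singleton] at this
    rcases this with h | h | h
    · exact absurd h h3.2.2
    · exact absurd h.symm h3.2.1
    · exact h
  have nxnx : ∀ {a b}, IsAdjacent F a b → nx b (nx a b) = a := by
    intro a b h
    obtain ⟨f, hf, hf', -, h2, -⟩ := hnx a b h
    obtain ⟨g, hg, hg', h4, -⟩ := hnx _ _ (adj h)
    obtain rfl := uniq f hf g hg _ h2 h4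
    rw [hg'] at hf'
    refine third (hg' ▸ hg) ?_
    rw [hf']; ext; simp; tauto
  have ne : ∀ {a b}, IsAdjacent F a b →
      ({a, b, nx a b} : Finset V) ≠ ({b, a, nx b a} : Finset V) := by
    intro a b h heq
    obtain ⟨f, hf, hf', h1, h2, h3⟩ := hnx a b h
    obtain ⟨g, hg, hg', h4, h5, h6⟩ := hnx b a h.symm
    rw [← hf', ← hg'] at heq
    subst heq
    have hd := third_ne hF (hf' ▸ hf)
    simp only [orientedEdges, Finset.mem_insert, Finset.mem_singleton, Prod.mk.injEq] at *
    grind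
  refine ⟨⟨hF, ⟨IsAdjacent F, ⟨fun _ _ h => IsAdjacent.symm h⟩, ⟨fun a h => h.1 rfl⟩⟩, nx,
    fun _ _ => Iff.rfl, adj, nxnx, ?_, mem, ?_⟩⟩
  · intro a b h heq
    apply ne h
    rw [heq]; ext; simp; tauto
  · intro f hf a ha b hb hab
    have h : IsAdjacent F a b := ⟨hab, (pair_mem_edges_iff hab).2 ⟨f, hf, ha, hb⟩⟩
    have hc := card_faces_of_pair hF h
    by_contra! hcon
    have hsub : ({f, {a, b, nx a b}, {b, a, nx b a}} : Finset (Finset V)) ⊆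
        F.filter (fun f => a ∈ f ∧ b ∈ f) := by
      intro g hg
      simp only [Finset.mem_insert, Finset.mem_singleton] at hg
      rcases hg with rfl | rfl | rfl
      · simp [*]
      · simp [mem h]
      · simp [mem h.symm]
    have := Finset.card_le_card hsub
    rw [Finset.card_eq_three.2 ⟨_, _, _, hcon.1, hcon.2, ne h, rfl⟩] at this
    omega

end

namespace OrientedTriangulation

variable {V : Type*} [DecidableEq V] {F : Finset (Finset V)} (K : OrientedTriangulation F)

/-- The face on the left of an oriented edge. -/
def tri (a b : V) : Finset V := {a, b, K.nx a b}

variable {K} {a b v : V}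

theorem tri_mem (h : K.G.Adj a b) : K.tri a b ∈ F := K.mem_face h

theorem tri_rot (h : K.G.Adj a b) : K.tri b (K.nx a b) = K.tri a b := by
  simp only [tri, K.nx_nx h]; ext; simp; tauto

theorem adj_nx' (h : K.G.Adj a b) : K.G.Adj a (K.nx a b) := by
  have := K.adj_nx (K.adj_nx h)
  rw [K.nx_nx h] at this
  exact this.symm

theorem nx_nx' (h : K.G.Adj a b) : K.nx (K.nx a b) a = b := by
  have := K.nx_nx (K.adj_nx h)
  rwa [K.nx_nx h] at this

theorem tri_rot' (h : K.G.Adj a b) : K.tri (K.nx a b) a = K.tri a b := by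
  rw [← tri_rot h, ← tri_rot (K.adj_nx h), K.nx_nx h]

theorem mem_tri {x : V} : x ∈ K.tri a b ↔ x = a ∨ x = b ∨ x = K.nx a b := by simp [tri]

theorem adj_iff_exists : K.G.Adj a b ↔ a ≠ b ∧ ∃ f ∈ F, a ∈ f ∧ b ∈ f := by
  rw [K.adj_iff]
  constructor
  · exact fun h => ⟨h.1, (pair_mem_edges_iff h.1).1 h.2⟩
  · exact fun h => ⟨h.1, (pair_mem_edges_iff h.1).2 h.2⟩

theorem eq_tri_or {f : Finset V} (hf : f ∈ F) (ha : a ∈ f) (hb : b ∈ f) (hab : a ≠ b) :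
    f = K.tri a b ∨ f = K.tri b a := K.eq_or f hf a ha b hb hab

theorem nx_notMem_tri (h : K.G.Adj a b) : K.nx b a ∉ K.tri a b := by
  rw [mem_tri]
  rintro (h1 | h1 | h1)
  · exact (K.adj_nx h.symm).ne h1.symm
  · exact (adj_nx' h.symm).ne h1.symm
  · exact K.nx_ne h h1.symm

theorem tri_ne (h : K.G.Adj a b) : K.tri a b ≠ K.tri b a := by
  intro heq
  apply nx_notMem_tri h
  rw [heq, mem_tri]; simp

theorem tri_left_cancel (ha : K.G.Adj v a) (hb : K.G.Adj v b) (h : K.tri v a = K.tri v b) :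
    a = b := by
  by_contra hne
  have h1 : a ∈ K.tri v b := by rw [← h, mem_tri]; simp
  have h2 : b ∈ K.tri v a := by rw [h, mem_tri]; simp
  rw [mem_tri] at h1 h2
  have h1' : a = K.nx v b := by
    rcases h1 with h1 | h1 | h1
    · exact absurd h1.symm ha.ne
    · exact absurd h1 hne
    · exact h1
  have h2' : b = K.nx v a := by
    rcases h2 with h1 | h1 | h1
    · exact absurd h1.symm hb.ne
    · exact absurd h1.symm hne
    · exact h1
  apply K.nx_ne ha
  rw [← h2']
  subst h1'
  exact (nx_nx' hb).symm

theorem mem_vertices_of_adj (h : K.G.Adj a b) : a ∈ vertices F := by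
  simp only [vertices, Finset.mem_sup]
  exact ⟨_, tri_mem h, by simp [tri]⟩

variable (K)

open Classical in
/-- The neighbours of a vertex. -/
noncomputable def nbrs (v : V) : Finset V := (vertices F).filter (K.G.Adj v)

variable {K}

theorem mem_nbrs : a ∈ K.nbrs v ↔ K.G.Adj v a := by
  simp only [nbrs, Finset.mem_filter, and_iff_right_iff_imp]
  exact fun h => mem_vertices_of_adj h.symm

theorem exists_of_mem_edges {e : Finset V} (he : e ∈ edges F) :
    ∃ a b, K.G.Adj a b ∧ e = {a, b} := by
  obtain ⟨a, b, hab, rfl⟩ := Finset.card_eq_two.1 (by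
    simp only [edges, Finset.mem_biUnion, Finset.mem_powersetCard] at he
    exact he.choose_spec.2.2)
  exact ⟨a, b, (K.adj_iff a b).2 ⟨hab, he⟩, rfl⟩

theorem card_nbrs (v : V) : (K.nbrs v).card = degree F v := by
  refine Finset.card_bij (fun a _ => {v, a}) ?_ ?_ ?_
  · intro a ha
    simp [((K.adj_iff _ _).1 (mem_nbrs.1 ha)).2]
  · intro a ha b hb h
    have : a ∈ ({v, b} : Finset V) := by rw [← h]; simp
    simp only [Finset.mem_insert, Finset.mem_singleton] at this
    exact this.resolve_left (mem_nbrs.1 ha).ne'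
  · intro e he
    rw [Finset.mem_filter] at he
    obtain ⟨a, b, hab, rfl⟩ := exists_of_mem_edges (K := K) he.1
    have hv := he.2
    simp only [Finset.mem_insert, Finset.mem_singleton] at hv
    rcases hv with rfl | rfl
    · exact ⟨b, mem_nbrs.2 hab, rfl⟩
    · exact ⟨a, mem_nbrs.2 hab.symm, Finset.pair_comm _ _⟩

variable (K) in
/-- The cyclic permutation of the neighbours of a vertex given by the orientation. -/
def rot (v : V) : Equiv.Perm {b // K.G.Adj v b} where
  toFun b := ⟨K.nx v b, adj_nx' b.2⟩
  invFun b := ⟨K.nx b v, K.adj_nx b.2.symm⟩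
  left_inv b := Subtype.ext (nx_nx' b.2)
  right_inv b := Subtype.ext (K.nx_nx b.2.symm)

theorem sameCycle_rot (a b : {b // K.G.Adj v b}) : (K.rot v).SameCycle a b := by
  have key : ∀ g, Relation.ReflTransGen (fun x y => x ∈ F ∧ y ∈ F ∧ v ∈ x ∧ v ∈ y ∧
      (x ∩ y).card = 2) (K.tri v a) g → ∃ c, (K.rot v).SameCycle a c ∧ g = K.tri v c.1 := by
    intro g hg
    induction hg with
    | refl => exact ⟨a, .refl _ _, rfl⟩
    | tail _ hs ih =>
      rename_i f g _
      obtain ⟨c, hc, rfl⟩ := ih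
      obtain ⟨hf, hg, hvf, hvg, hcard⟩ := hs
      obtain ⟨x, hx, hxv⟩ := Finset.exists_mem_ne (by omega : 1 < (K.tri v c ∩ g).card) v
      rw [Finset.mem_inter, mem_tri] at hx
      have hvx : K.G.Adj v x := adj_iff_exists.2 ⟨hxv.symm, g, hg, hvg, hx.2⟩
      have hx' : (K.rot v).SameCycle a ⟨x, hvx⟩ := by
        rcases hx.1 with h | h | h
        · exact absurd h hxv
        · subst h; exact hc
        · subst h; exact hc.trans (Equiv.Perm.sameCycle_apply_right.2 (.refl _ _))
      rcases eq_tri_or (K := K) hg hvg hx.2 hxv.symm with h | h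
      · exact ⟨_, hx', h⟩
      · refine ⟨_, hx'.trans (Equiv.Perm.sameCycle_symm_apply_right.2 (.refl _ _)), ?_⟩
        rw [h]
        exact (tri_rot hvx.symm).symm
  obtain ⟨c, hc, h⟩ := key _ (K.closed.2.2.2 v _ (tri_mem a.2) _ (tri_mem b.2)
    (by simp [tri]) (by simp [tri]))
  obtain rfl := Subtype.ext (tri_left_cancel b.2 c.2 h)
  exact hc

variable (K) in
/-- The `k`-th neighbour of `v` in cyclic order, starting from `a`. -/
def fan (v a : V) (k : ℕ) : V := (K.nx v)^[k] a

@[simp] theorem fan_zero : K.fan v a 0 = a := rfl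

theorem fan_succ (k : ℕ) : K.fan v a (k + 1) = K.nx v (K.fan v a k) :=
  Function.iterate_succ_apply' _ _ _

theorem fan_fan (m n : ℕ) : K.fan v (K.fan v a m) n = K.fan v a (m + n) := by
  rw [fan, fan, fan, ← Function.iterate_add_apply, add_comm]

theorem fan_eq_rot_pow (h : K.G.Adj v a) (k : ℕ) :
    K.fan v a k = ((K.rot v ^ k) ⟨a, h⟩).1 := by
  induction k with
  | zero => rfl
  | succ k ih => rw [fan_succ, ih, pow_succ', Equiv.Perm.mul_apply]; rfl

theorem fan_adj (h : K.G.Adj v a) (k : ℕ) : K.G.Adj v (K.fan v a k) := by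
  rw [fan_eq_rot_pow h]; exact Subtype.prop _

theorem tri_fan_succ (h : K.G.Adj v a) (k : ℕ) :
    K.tri (K.fan v a (k + 1)) v = K.tri v (K.fan v a k) := by
  rw [fan_succ, tri_rot' (fan_adj h k)]

theorem exists_isCycleOn (v : V) : ∃ s : Finset {b // K.G.Adj v b},
    (K.rot v).IsCycleOn s ∧ s.card = degree F v ∧ ∀ x, x ∈ s := by
  classical
  let _ : Fintype {b // K.G.Adj v b} := Fintype.subtype (K.nbrs v) fun x => mem_nbrs
  refine ⟨Finset.univ, ⟨?_, fun x _ y _ => sameCycle_rot x y⟩, ?_, fun x => Finset.mem_univ x⟩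
  · simp
  · rw [Finset.card_univ, ← card_nbrs (K := K)]
    exact Fintype.card_of_subtype _ fun x => mem_nbrs

theorem fan_degree (h : K.G.Adj v a) : K.fan v a (degree F v) = a := by
  obtain ⟨s, hs, hc, hm⟩ := exists_isCycleOn (K := K) v
  rw [fan_eq_rot_pow h, ← hc, hs.pow_card_apply (hm _)]

theorem fan_injOn (h : K.G.Adj v a) {i j : ℕ} (hi : i < degree F v) (hj : j < degree F v)
    (hij : K.fan v a i = K.fan v a j) : i = j := by
  obtain ⟨s, hs, hc, hm⟩ := exists_isCycleOn (K := K) v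
  rw [fan_eq_rot_pow h, fan_eq_rot_pow h, Subtype.coe_inj, hs.pow_apply_eq_pow_apply (hm _), hc]
    at hij
  exact Nat.ModEq.eq_of_lt_of_lt hij hi hj

theorem exists_fan (ha : K.G.Adj v a) (hb : K.G.Adj v b) : ∃ k < degree F v, K.fan v a k = b := by
  obtain ⟨s, hs, hc, hm⟩ := exists_isCycleOn (K := K) v
  obtain ⟨k, hk, h⟩ := hs.exists_pow_eq (hm ⟨a, ha⟩) (hm ⟨b, hb⟩)
  exact ⟨k, hc ▸ hk, by rw [fan_eq_rot_pow ha, h]⟩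

theorem nx_fan_zero (h : K.G.Adj v a) : K.nx a v = K.fan v a (degree F v - 1) := by
  have hd : 0 < degree F v := by
    rw [← card_nbrs (K := K)]; exact Finset.card_pos.2 ⟨a, mem_nbrs.2 h⟩
  have h1 := fan_succ (K := K) (v := v) (a := a) (degree F v - 1)
  rw [Nat.sub_add_cancel hd, fan_degree h] at h1
  conv_lhs => rw [h1]
  exact nx_nx' (fan_adj h _)

end OrientedTriangulation

namespace OrientedTriangulation

variable {V : Type*} [DecidableEq V] {F : Finset (Finset V)} (K : OrientedTriangulation F)
variable {M : Type*} [Group M]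

/-- The product of the transports met when turning around `v` across `n` edges, starting with the
edge to `a`. -/
def fanProd (T : V → V → M) (v a : V) : ℕ → M
  | 0 => 1
  | n + 1 => T v (K.fan v a n) * fanProd T v a n

/-- A flat transport: `T a b` is attached to crossing the edge `ab` from the right of `(a, b)` to
its left, and the transport around each vertex is trivial. -/
structure IsFlat (T : V → V → M) : Prop where
  inv : ∀ {a b}, K.G.Adj a b → T b a = (T a b)⁻¹
  prod : ∀ {v a}, K.G.Adj v a → K.fanProd T v a (degree F v) = 1

/-- The transport obtained from `T` by changing the frame of each face `f` by `g f`. -/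
def gauge (g : Finset V → M) (T : V → V → M) (a b : V) : M :=
  g (K.tri a b) * T a b * (g (K.tri b a))⁻¹

/-- The coboundary of a sign function on faces. -/
def cob (X : Finset V → ℤˣ) (a b : V) : ℤˣ := X (K.tri a b) * X (K.tri b a)

variable {K} {T : V → V → M} {a b v : V}

theorem fanProd_add (m n : ℕ) :
    K.fanProd T v a (m + n) = K.fanProd T v (K.fan v a m) n * K.fanProd T v a m := by
  induction n with
  | zero => simp [fanProd]
  | succ n ih => rw [← add_assoc, fanProd, ih, fanProd, fan_fan, mul_assoc]

theorem fanProd_eq_one {n : ℕ} (h : ∀ j < n, T v (K.fan v a j) = 1) : K.fanProd T v a n = 1 := by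
  induction n with
  | zero => rfl
  | succ n ih => rw [fanProd, h n (by omega), ih fun j hj => h j (by omega), one_mul]

theorem fanProd_eq_first {n : ℕ} (hn : 0 < n)
    (h : ∀ j, 0 < j → j < n → T v (K.fan v a j) = 1) : K.fanProd T v a n = T v a := by
  obtain ⟨n, rfl⟩ : ∃ m, n = 1 + m := ⟨n - 1, by omega⟩
  rw [fanProd_add, fanProd_eq_one, one_mul]
  · simp [fanProd]
  · intro j hj
    rw [fan_fan]
    exact h _ (by omega) (by omega)

theorem fanProd_segment {m n : ℕ} (hn : m < n)
    (h : ∀ j, m < j → j < n → T v (K.fan v a j) = 1) :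
    K.fanProd T v a n = T v (K.fan v a m) * K.fanProd T v a m := by
  obtain ⟨n, rfl⟩ : ∃ p, n = m + p := ⟨n - m, by omega⟩
  rw [fanProd_add, fanProd_eq_first (by omega)]
  intro j h1 h2
  rw [fan_fan]
  exact h _ (by omega) (by omega)

theorem degree_pos (h : K.G.Adj v a) : 0 < degree F v := by
  rw [← card_nbrs (K := K)]; exact Finset.card_pos.2 ⟨a, mem_nbrs.2 h⟩

theorem fan_ne (h : K.G.Adj v a) {j : ℕ} (hj : 0 < j) (hj' : j < degree F v) :
    K.fan v a j ≠ a := fun h' =>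
  hj.ne' (fan_injOn h hj' (degree_pos h) h')

namespace IsFlat

theorem eq_one_of_forall_ne (hT : K.IsFlat T) (h : K.G.Adj v a)
    (h1 : ∀ b, K.G.Adj v b → b ≠ a → T v b = 1) : T v a = 1 := by
  rw [← hT.prod h, fanProd_eq_first (degree_pos h)]
  exact fun j hj hj' => h1 _ (fan_adj h _) (fan_ne h hj hj')

theorem mul_eq_one (hT : K.IsFlat T) (ha : K.G.Adj v a) (hb : K.G.Adj v b) (hab : a ≠ b)
    (h1 : ∀ c, K.G.Adj v c → c ≠ a → c ≠ b → T v c = 1) : T v b * T v a = 1 := by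
  obtain ⟨k, hk, rfl⟩ := exists_fan ha hb
  have hk0 : 0 < k := by
    rcases k.eq_zero_or_pos with rfl | h
    · exact absurd rfl hab
    · exact h
  rw [← hT.prod ha, fanProd_segment hk, fanProd_eq_first hk0]
  · exact fun j hj hj' => h1 _ (fan_adj ha _) (fan_ne ha hj (by omega))
      fun h => hj'.ne (fan_injOn ha (by omega) hk h)
  · exact fun j hj hj' => h1 _ (fan_adj ha _) (fan_ne ha (by omega) (by omega))
      fun h => hj.ne' (fan_injOn ha (by omega) hk h)

theorem mul_four_eq_one (hT : K.IsFlat T) (ha : K.G.Adj v a) {i j k : ℕ} (hi : 0 < i) (hij : i < j)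
    (hjk : j < k) (hk : k < degree F v)
    (h1 : ∀ m < degree F v, m ≠ 0 → m ≠ i → m ≠ j → m ≠ k → T v (K.fan v a m) = 1) :
    T v (K.fan v a k) * (T v (K.fan v a j) * (T v (K.fan v a i) * T v a)) = 1 := by
  rw [← hT.prod ha, fanProd_segment hk, fanProd_segment hjk, fanProd_segment hij,
    fanProd_eq_first hi] <;>
  exact fun m h h' => h1 m (by omega) (by omega) (by omega) (by omega) (by omega)

end IsFlat

theorem fanProd_gauge (g : Finset V → M) (h : K.G.Adj v a) (n : ℕ) :
    K.fanProd (K.gauge g T) v a n =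
      g (K.tri (K.fan v a n) v) * K.fanProd T v a n * (g (K.tri a v))⁻¹ := by
  induction n with
  | zero => simp [fanProd]
  | succ n ih =>
    rw [fanProd, ih, fanProd, tri_fan_succ h, gauge]
    group

theorem IsFlat.gauge (hT : K.IsFlat T) (g : Finset V → M) : K.IsFlat (K.gauge g T) where
  inv h := by
    rw [OrientedTriangulation.gauge, hT.inv h, OrientedTriangulation.gauge]
    group
  prod h := by
    rw [fanProd_gauge g h, hT.prod h, fan_degree h]
    group

theorem gauge_gauge (g g' : Finset V → M) : K.gauge g' (K.gauge g T) = K.gauge (g' * g) T := by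
  ext a b
  simp only [gauge, Pi.mul_apply]
  group

theorem isFlat_one : K.IsFlat (fun _ _ => 1 : V → V → M) :=
  ⟨fun _ => by simp, fun _ => fanProd_eq_one fun _ _ => rfl⟩

theorem isFlat_cob (X : Finset V → ℤˣ) : K.IsFlat (K.cob X) := by
  convert (isFlat_one (K := K)).gauge X using 1
  ext a b : 2
  simp [cob, gauge, Int.units_inv_eq_self]

theorem cob_eq_one_iff (X : Finset V → ℤˣ) : K.cob X a b = 1 ↔ X (K.tri a b) = X (K.tri b a) := by
  rw [cob, mul_eq_one_iff_eq_inv, Int.units_inv_eq_self]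

section Coloring

theorem perm_eq_of_two {σ τ : Equiv.Perm (Fin 3)} {x y : Fin 3} (hxy : x ≠ y) (hx : σ x = τ x)
    (hy : σ y = τ y) : σ = τ := by
  ext z : 1
  by_cases hzx : z = x
  · rw [hzx, hx]
  by_cases hzy : z = y
  · rw [hzy, hy]
  have h1 := σ.injective.ne hxy
  have h2 := σ.injective.ne hzx
  have h3 := σ.injective.ne hzy
  have h4 := τ.injective.ne hzx
  have h5 := τ.injective.ne hzy
  rw [← hx] at h4
  rw [← hy] at h5
  omega

theorem exists_perm_of_two : ∀ {x y x' y' : Fin 3}, x ≠ y → x' ≠ y' →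
    ∃ σ : Equiv.Perm (Fin 3), σ x = x' ∧ σ y = y' := by
  decide

theorem exists_faceColoring (hF : ∀ f ∈ F, f.card = 3) :
    ∃ col : Finset V → V → Fin 3, ∀ f ∈ F, Set.InjOn (col f) f := by
  have : ∀ f : Finset V, ∃ c : V → Fin 3, f ∈ F → Set.InjOn c f := by
    intro f
    by_cases hf : f ∈ F
    · let e := Finset.equivFinOfCardEq (hF f hf)
      refine ⟨fun v => if h : v ∈ f then e ⟨v, h⟩ else 0, fun _ x hx y hy h => ?_⟩
      simpa [Finset.mem_coe.1 hx, Finset.mem_coe.1 hy] using h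
    · exact ⟨fun _ => 0, fun h => absurd h hf⟩
  choose c hc using this
  exact ⟨c, hc⟩

/-- The transport comparing proper colorings of adjacent faces is flat on an even
triangulation. -/
theorem exists_isFlat_of_faceColoring (heven : ∀ v ∈ vertices F, Even (degree F v))
    {col : Finset V → V → Fin 3} (hcol : ∀ f ∈ F, Set.InjOn (col f) f) :
    ∃ T : V → V → Equiv.Perm (Fin 3), K.IsFlat T ∧ ∀ a b, K.G.Adj a b →
      T a b (col (K.tri b a) a) = col (K.tri a b) a ∧
      T a b (col (K.tri b a) b) = col (K.tri a b) b := by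
  have hne : ∀ {a b}, K.G.Adj a b → col (K.tri a b) a ≠ col (K.tri a b) b := fun h =>
    (hcol _ (tri_mem h)).ne (by simp [tri]) (by simp [tri]) h.ne
  have hne' : ∀ {a b}, K.G.Adj a b → col (K.tri b a) a ≠ col (K.tri b a) b := fun h =>
    (hne h.symm).symm
  have : ∀ a b, ∃ σ : Equiv.Perm (Fin 3), K.G.Adj a b →
      σ (col (K.tri b a) a) = col (K.tri a b) a ∧ σ (col (K.tri b a) b) = col (K.tri a b) b := by
    intro a b
    by_cases h : K.G.Adj a b
    · obtain ⟨σ, hσ⟩ := exists_perm_of_two (hne' h) (hne h)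
      exact ⟨σ, fun _ => hσ⟩
    · exact ⟨1, fun h' => absurd h' h⟩
  choose T hT using this
  refine ⟨T, ⟨fun {a b} h => ?_, fun {v a} h => ?_⟩, hT⟩
  · rw [eq_inv_iff_mul_eq_one]
    refine perm_eq_of_two (hne' h) ?_ ?_
    · simp [(hT a b h).1, (hT b a h.symm).2]
    · simp [(hT a b h).2, (hT b a h.symm).1]
  · have h0 : col (K.tri a v) v ≠ col (K.tri a v) a := hne' h
    have hv : ∀ n, K.fanProd T v a n (col (K.tri a v) v) = col (K.tri (K.fan v a n) v) v := by
      intro n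
      induction n with
      | zero => rfl
      | succ n ih =>
        rw [fanProd, Equiv.Perm.mul_apply, ih, (hT _ _ (fan_adj h n)).1, tri_fan_succ h]
    have ha : ∀ n, (Even n → K.fanProd T v a n (col (K.tri a v) a) =
          col (K.tri (K.fan v a n) v) (K.fan v a n)) ∧
        (¬ Even n → K.fanProd T v a n (col (K.tri a v) a) ≠
          col (K.tri (K.fan v a n) v) (K.fan v a n)) := by
      intro n
      induction n with
      | zero => exact ⟨fun _ => rfl, fun h => absurd Even.zero h⟩
      | succ n ih =>
        have hn := fan_adj h n
        have hd : ∀ x ∈ K.tri v (K.fan v a n), ∀ y ∈ K.tri v (K.fan v a n), x ≠ y →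
            col (K.tri v (K.fan v a n)) x ≠ col (K.tri v (K.fan v a n)) y :=
          fun x hx y hy => (hcol _ (tri_mem hn)).ne hx hy
        have hd1 := hd v (by simp [tri]) (K.fan v a n) (by simp [tri]) hn.ne
        have hd2 := hd v (by simp [tri]) (K.fan v a (n + 1)) (by simp [tri, fan_succ])
          (fan_adj h _).ne
        have hd3 := hd (K.fan v a n) (by simp [tri]) (K.fan v a (n + 1)) (by simp [tri, fan_succ])
          (by rw [fan_succ]; exact (K.adj_nx hn).ne)
        have hPv := hv (n + 1)
        have hPn := (K.fanProd T v a (n + 1)).injective.ne h0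
        rw [hPv, tri_fan_succ h] at hPn
        rw [tri_fan_succ h]
        by_cases hev : Even n
        · refine ⟨fun h' => absurd hev (by simpa [Nat.even_add_one] using h'), fun _ => ?_⟩
          rw [fanProd, Equiv.Perm.mul_apply, ih.1 hev, (hT _ _ hn).2]
          exact hd3
        · refine ⟨fun _ => ?_, fun h' => absurd (Nat.even_add_one.2 hev) h'⟩
          have := (T v (K.fan v a n)).injective.ne (ih.2 hev)
          rw [(hT _ _ hn).2] at this
          rw [fanProd, Equiv.Perm.mul_apply] at hPn ⊢
          omega
    have hev := heven v (mem_vertices_of_adj h)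
    have h1 := (ha _).1 hev
    have h2 := hv (degree F v)
    rw [fan_degree h] at h1 h2
    exact perm_eq_of_two h0 (by simpa using h2) (by simpa using h1)

end Coloring

end OrientedTriangulation

theorem isPath_append {V : Type*} {G : SimpleGraph V} {u v w : V} {p : G.Walk u v}
    {r : G.Walk v w} (hp : p.IsPath) (hr : r.IsPath)
    (h : ∀ x ∈ p.support, x ∈ r.support → x = v) : (p.append r).IsPath := by
  induction p with
  | nil => simpa using hr
  | cons hadj p ih =>
    rw [Walk.cons_isPath_iff] at hp
    rw [Walk.cons_append, Walk.cons_isPath_iff]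
    refine ⟨ih hp.1 hr fun x hx => h x (by simp [hx]), fun hmem => ?_⟩
    rcases Walk.mem_support_append_iff _ _ |>.1 hmem with h1 | h1
    · exact hp.2 h1
    · exact hp.2 (h _ (by simp) h1 ▸ p.end_mem_support)

namespace OrientedTriangulation

variable {V : Type*} [DecidableEq V] {F : Finset (Finset V)} {K : OrientedTriangulation F}
variable {M : Type*} [Group M] {T : V → V → M} {a b q v : V}

section Cut

/-- The edges of a walk, as pairs of vertices. -/
def walkEdges {u v : V} (p : K.G.Walk u v) : Finset (Finset V) :=
  p.edges.toFinset.image Sym2.toFinset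

theorem mem_walkEdges {u v : V} {p : K.G.Walk u v} {e : Finset V} :
    e ∈ walkEdges p ↔ ∃ x y, s(x, y) ∈ p.edges ∧ e = {x, y} := by
  simp only [walkEdges, Finset.mem_image, List.mem_toFinset]
  constructor
  · rintro ⟨e, he, rfl⟩
    induction e with | _ x y => exact ⟨x, y, he, Sym2.toFinset_mk_eq⟩
  · rintro ⟨x, y, he, rfl⟩
    exact ⟨_, he, Sym2.toFinset_mk_eq⟩

theorem sym2_toFinset_injective : Function.Injective (Sym2.toFinset (α := V)) := by
  intro e e' h
  ext z
  rw [← Sym2.mem_toFinset, h, Sym2.mem_toFinset]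

theorem pair_eq_pair_iff {x y : V} : ({a, b} : Finset V) = {x, y} ↔ s(a, b) = s(x, y) := by
  rw [← Sym2.toFinset_mk_eq, ← Sym2.toFinset_mk_eq, sym2_toFinset_injective.eq_iff]

theorem pair_mem_walkEdges {u v : V} {p : K.G.Walk u v} :
    ({a, b} : Finset V) ∈ walkEdges p ↔ s(a, b) ∈ p.edges := by
  rw [mem_walkEdges]
  constructor
  · rintro ⟨x, y, he, h⟩
    rwa [pair_eq_pair_iff.1 h]
  · exact fun h => ⟨a, b, h, rfl⟩

theorem walkEdges_subset {u v : V} (p : K.G.Walk u v) : walkEdges p ⊆ edges F := by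
  intro e he
  obtain ⟨x, y, h, rfl⟩ := mem_walkEdges.1 he
  exact ((K.adj_iff x y).1 (p.adj_of_mem_edges h)).2

theorem card_filter_walkEdges {p : K.G.Walk q q} (hp : p.IsCycle) (v : V) :
    ((walkEdges p).filter (fun e => v ∈ e)).card = 0 ∨
      ((walkEdges p).filter (fun e => v ∈ e)).card = 2 := by
  by_cases hv : v ∈ p.support
  · right
    obtain ⟨x, y, hxy, h⟩ := Set.ncard_eq_two.1 (hp.ncard_neighborSet_toSubgraph_eq_two hv)
    have key : ∀ w, s(v, w) ∈ p.edges ↔ w = x ∨ w = y := by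
      intro w
      rw [← Walk.adj_toSubgraph_iff_mem_edges, ← Subgraph.mem_neighborSet, h]
      simp
    have : (walkEdges p).filter (fun e => v ∈ e) = {{v, x}, {v, y}} := by
      ext e
      simp only [Finset.mem_filter, mem_walkEdges, Finset.mem_insert, Finset.mem_singleton]
      constructor
      · rintro ⟨⟨c, d, hcd, rfl⟩, hv⟩
        simp only [Finset.mem_insert, Finset.mem_singleton] at hv
        rcases hv with rfl | rfl
        · rcases (key _).1 hcd with rfl | rfl <;> simp
        · rw [Sym2.eq_swap] at hcd
          rcases (key _).1 hcd with rfl | rfl <;> simp [Finset.pair_comm]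
      · rintro (rfl | rfl)
        · exact ⟨⟨v, x, (key x).2 (.inl rfl), rfl⟩, by simp⟩
        · exact ⟨⟨v, y, (key y).2 (.inr rfl), rfl⟩, by simp⟩
    rw [this, Finset.card_pair]
    intro heq
    have hx : x ∈ ({v, y} : Finset V) := by rw [← heq]; simp
    simp only [Finset.mem_insert, Finset.mem_singleton] at hx
    exact (p.adj_of_mem_edges ((key x).2 (.inl rfl))).ne' (hx.resolve_right hxy)
  · left
    rw [Finset.card_eq_zero, Finset.filter_eq_empty_iff]
    intro e he hve
    obtain ⟨x, y, h, rfl⟩ := mem_walkEdges.1 he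
    simp only [Finset.mem_insert, Finset.mem_singleton] at hve
    rcases hve with rfl | rfl
    · exact hv (p.fst_mem_support_of_mem_edges h)
    · exact hv (p.snd_mem_support_of_mem_edges h)

theorem reflTransGen_walkEdges {C : Finset (Finset V)} {u v : V} (p : K.G.Walk u v)
    (hp : walkEdges p ⊆ C) {e₀ : Finset V} (h₀ : e₀ ∈ C) (hu : u ∈ e₀) {e : Finset V}
    (he : e ∈ walkEdges p) :
    Relation.ReflTransGen (fun x y => x ∈ C ∧ y ∈ C ∧ (x ∩ y).Nonempty) e₀ e := by
  induction p generalizing e₀ with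
  | nil => simp [walkEdges] at he
  | cons h p ih =>
    rename_i u x w
    have hC : ({u, x} : Finset V) ∈ C := hp (pair_mem_walkEdges.2 (by simp))
    have h1 : Relation.ReflTransGen (fun x y => x ∈ C ∧ y ∈ C ∧ (x ∩ y).Nonempty) e₀ {u, x} :=
      .single ⟨h₀, hC, u, by simp [hu]⟩
    have hsub : walkEdges p ⊆ walkEdges (.cons h p) := by
      intro e he
      rw [mem_walkEdges] at he ⊢
      obtain ⟨c, d, hcd, rfl⟩ := he
      exact ⟨c, d, by simp [hcd], rfl⟩
    obtain ⟨c, d, hcd, rfl⟩ := mem_walkEdges.1 he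
    rw [Walk.edges_cons, List.mem_cons] at hcd
    rcases hcd with hcd | hcd
    · rwa [← Sym2.toFinset_mk_eq, hcd, Sym2.toFinset_mk_eq]
    · exact h1.trans (ih (hsub.trans hp) hC (by simp) (pair_mem_walkEdges.2 hcd))

variable (F) in
/-- After cutting along some simple closed curve, the triangulation is 3-colorable. -/
def ColorableAfterCut : Prop :=
  ∃ C : Finset (Finset V), C ⊆ edges F ∧ C.Nonempty ∧
      (∀ v : V, (C.filter (fun e => v ∈ e)).card = 0 ∨
                (C.filter (fun e => v ∈ e)).card = 2) ∧
      (∀ e ∈ C, ∀ e' ∈ C,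
        Relation.ReflTransGen
          (fun x y => x ∈ C ∧ y ∈ C ∧ (x ∩ y).Nonempty) e e') ∧
      ∃ col : Finset V → V → Fin 3,
        (∀ f ∈ F, ∀ u ∈ f, ∀ w ∈ f, u ≠ w → col f u ≠ col f w) ∧
        (∀ f ∈ F, ∀ g ∈ F, f ≠ g → (f ∩ g).card = 2 → f ∩ g ∉ C →
          ∀ u ∈ f ∩ g, col f u = col g u)

theorem colorableAfterCut_of_isCycle {col : Finset V → V → Fin 3}
    (hcol : ∀ f ∈ F, Set.InjOn (col f) f) {T : V → V → Equiv.Perm (Fin 3)}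
    (hT : ∀ a b, K.G.Adj a b → T a b (col (K.tri b a) a) = col (K.tri a b) a ∧
      T a b (col (K.tri b a) b) = col (K.tri a b) b)
    (g : Finset V → Equiv.Perm (Fin 3)) {p : K.G.Walk q q} (hp : p.IsCycle)
    (hg : ∀ a b, K.G.Adj a b → s(a, b) ∉ p.edges → K.gauge g T a b = 1) :
    ColorableAfterCut F := by
  obtain ⟨x, hx, p', rfl⟩ : ∃ x, ∃ (h : K.G.Adj q x) (p' : K.G.Walk x q), p = .cons h p' := by
    cases p with
    | nil => exact absurd rfl hp.ne_nil
    | cons h p' => exact ⟨_, h, p', rfl⟩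
  have hC : ({q, x} : Finset V) ∈ walkEdges (.cons hx p') := pair_mem_walkEdges.2 (by simp)
  refine ⟨walkEdges (.cons hx p'), walkEdges_subset _, ⟨_, hC⟩, card_filter_walkEdges hp, ?_,
    fun f v => g f (col f v), ?_, ?_⟩
  · intro e he e' he'
    have hs : Std.Symm (fun x y => x ∈ walkEdges (.cons hx p') ∧ y ∈ walkEdges (.cons hx p') ∧
        (x ∩ y).Nonempty) :=
      ⟨fun x y h => ⟨h.2.1, h.1, by rw [Finset.inter_comm]; exact h.2.2⟩⟩
    exact (Relation.ReflTransGen.stdSymm.symm _ _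
      (reflTransGen_walkEdges _ subset_rfl hC (by simp) he)).trans
      (reflTransGen_walkEdges _ subset_rfl hC (by simp) he')
  · exact fun f hf u hu w hw huw => (g f).injective.ne ((hcol f hf).ne hu hw huw)
  · have key : ∀ {a b}, K.G.Adj a b → s(a, b) ∉ (Walk.cons hx p').edges → ∀ u, u = a ∨ u = b →
        g (K.tri a b) (col (K.tri a b) u) = g (K.tri b a) (col (K.tri b a) u) := by
      intro a b hab h u hu
      have h1 := hg a b hab h
      rw [gauge, mul_inv_eq_one] at h1
      rw [← h1, Equiv.Perm.mul_apply]
      rcases hu with rfl | rfl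
      · rw [(hT _ _ hab).1]
      · rw [(hT _ _ hab).2]
    intro f hf g' hg' hne hcard hnot u hu
    obtain ⟨a, b, hab, hfg⟩ := Finset.card_eq_two.1 hcard
    have ha : a ∈ f ∩ g' := by simp [hfg]
    have hb : b ∈ f ∩ g' := by simp [hfg]
    rw [Finset.mem_inter] at ha hb
    have hadj : K.G.Adj a b := adj_iff_exists.2 ⟨hab, f, hf, ha.1, hb.1⟩
    rw [hfg, pair_mem_walkEdges] at hnot
    rw [hfg, Finset.mem_insert, Finset.mem_singleton] at hu
    rcases eq_tri_or (K := K) hf ha.1 hb.1 hab with rfl | rfl <;>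
    rcases eq_tri_or (K := K) hg' ha.2 hb.2 hab with rfl | rfl
    · exact absurd rfl hne
    · exact key hadj hnot u hu
    · exact (key hadj hnot u hu).symm
    · exact absurd rfl hne

end Cut

section Corner

theorem exists_fanWalk (h : K.G.Adj q a) {n : ℕ} (hn : n < degree F q) :
    ∃ w : K.G.Walk a (K.fan q a n), w.IsPath ∧ (∀ x ∈ w.support, ∃ k ≤ n, x = K.fan q a k) ∧
      ∀ k < n, s(K.fan q a k, K.fan q a (k + 1)) ∈ w.edges := by
  induction n with
  | zero => exact ⟨.nil, by simp, fun x hx => ⟨0, le_rfl, by simpa using hx⟩, by simp⟩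
  | succ n ih =>
    obtain ⟨w, hw, hs, he⟩ := ih (by omega)
    have hadj : K.G.Adj (K.fan q a n) (K.fan q a (n + 1)) := by
      rw [fan_succ]; exact K.adj_nx (fan_adj h n)
    refine ⟨w.concat hadj, ?_, ?_, ?_⟩
    · rw [Walk.concat_isPath_iff]
      refine ⟨hw, fun hmem => ?_⟩
      obtain ⟨k, hk, heq⟩ := hs _ hmem
      have := fan_injOn h hn (by omega) heq
      omega
    · intro x hx
      rw [Walk.support_concat, List.mem_append, List.mem_singleton] at hx
      rcases hx with hx | rfl
      · obtain ⟨k, hk, rfl⟩ := hs x hx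
        exact ⟨k, by omega, rfl⟩
      · exact ⟨n + 1, le_rfl, rfl⟩
    · intro k hk
      rw [Walk.edges_concat, List.concat_eq_append, List.mem_append, List.mem_singleton]
      rcases Nat.lt_succ_iff_lt_or_eq.1 hk with hk | rfl
      · exact .inl (he k hk)
      · exact .inr rfl

theorem tri_fan_eq (h : K.G.Adj v a) {k : ℕ} (hk : 0 < k) :
    K.tri (K.fan v a k) v = K.tri v (K.fan v a (k - 1)) := by
  obtain ⟨k, rfl⟩ : ∃ m, k = m + 1 := ⟨k - 1, by omega⟩
  exact tri_fan_succ h k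

theorem tri_fan_zero (h : K.G.Adj v a) :
    K.tri a v = K.tri v (K.fan v a (degree F v - 1)) := by
  rw [← tri_fan_eq h (degree_pos h), fan_degree h]

/-- Two arcs issuing from `q` with inverse transports can be merged into a single closed curve by
a change of frames in the corner between them. -/
theorem exists_isCycle_of_corner (hT : K.IsFlat T) {a' b' : V} (ha : K.G.Adj q a) {i : ℕ}
    (hi : 0 < i) (hid : i < degree F q) (hb : K.fan q a i = b)
    {P : K.G.Walk a a'} (hP : P.IsPath) (ha' : K.G.Adj a' q)
    {N : K.G.Walk b b'} (hN : N.IsPath) (hb' : K.G.Adj b' q)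
    (hqP : q ∉ P.support) (hqN : q ∉ N.support) (hdisj : ∀ x ∈ P.support, x ∉ N.support)
    (hk : ∀ k, 0 < k → k < i → K.fan q a k ∉ P.support ∧ K.fan q a k ∉ N.support)
    (hTr : ∀ x y, K.G.Adj x y → T x y ≠ 1 → s(x, y) = s(q, a) ∨ s(x, y) = s(q, b) ∨
      s(x, y) = s(q, a') ∨ s(x, y) = s(q, b') ∨ s(x, y) ∈ P.edges ∨ s(x, y) ∈ N.edges)
    (hprod : T q b * T q a = 1) :
    ∃ (g : Finset V → M) (E : K.G.Walk q q), E.IsCycle ∧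
      ∀ x y, K.G.Adj x y → s(x, y) ∉ E.edges → K.gauge g T x y = 1 := by
  classical
  subst hb
  obtain ⟨L, hL, hLs, hLe⟩ := exists_fanWalk ha hid
  have hqL : q ∉ L.support := by
    intro h
    obtain ⟨k, -, hk⟩ := hLs q h
    exact (fan_adj ha k).ne hk
  have hR : (P.reverse.append (L.append N)).IsPath := by
    refine isPath_append hP.reverse (isPath_append hL hN ?_) ?_
    · intro x hx hxN
      obtain ⟨k, hki, rfl⟩ := hLs x hx
      rcases k.eq_zero_or_pos with rfl | h0
      · exact absurd hxN (hdisj _ P.start_mem_support)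
      rcases hki.eq_or_lt with rfl | hlt
      · rfl
      · exact absurd hxN (hk k h0 hlt).2
    · intro x hxP hx
      rw [Walk.support_reverse, List.mem_reverse] at hxP
      rcases (Walk.mem_support_append_iff _ _).1 hx with hx | hx
      · obtain ⟨k, hki, rfl⟩ := hLs x hx
        rcases k.eq_zero_or_pos with rfl | h0
        · rfl
        rcases hki.eq_or_lt with rfl | hlt
        · exact absurd N.start_mem_support (hdisj _ hxP)
        · exact absurd hxP (hk k h0 hlt).1
      · exact absurd hx (hdisj _ hxP)
  have hqR : q ∉ (P.reverse.append (L.append N)).support := by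
    simp [Walk.mem_support_append_iff, hqP, hqL, hqN]
  refine ⟨fun f => if ∃ k < i, f = K.tri q (K.fan q a k) then T q (K.fan q a i) else 1,
    .cons ha'.symm ((P.reverse.append (L.append N)).concat hb'), ?_, ?_⟩
  · rw [Walk.cons_isCycle_iff, Walk.concat_isPath_iff]
    refine ⟨⟨hR, hqR⟩, fun hmem => ?_⟩
    rw [Walk.edges_concat, List.concat_eq_append, List.mem_append, List.mem_singleton] at hmem
    rcases hmem with hmem | hmem
    · exact hqR (Walk.fst_mem_support_of_mem_edges _ hmem)
    · have hab : a' = b' := by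
        rw [Sym2.eq_swap, Sym2.congr_left] at hmem
        exact hmem
      exact hdisj a' P.end_mem_support (hab ▸ N.end_mem_support)
  · generalize hg : (fun f => if ∃ k < i, f = K.tri q (K.fan q a k) then T q (K.fan q a i) else 1)
      = g
    have hgin : ∀ k < i, g (K.tri q (K.fan q a k)) = T q (K.fan q a i) := fun k hk => by
      rw [← hg]; exact if_pos ⟨k, hk, rfl⟩
    have hgout : ∀ k, i ≤ k → k < degree F q → g (K.tri q (K.fan q a k)) = 1 := fun k hk hkd => by
      rw [← hg]
      refine if_neg ?_
      rintro ⟨j, hj, h⟩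
      have := fan_injOn ha hkd (by omega) (tri_left_cancel (fan_adj ha _) (fan_adj ha _) h)
      omega
    have hTg := hT.gauge g
    simp only [Walk.edges_cons, Walk.edges_concat, List.concat_eq_append, Walk.edges_append,
      Walk.edges_reverse, List.mem_cons, List.mem_append, List.mem_reverse, List.not_mem_nil,
      or_false, not_or]
    have hq : ∀ y, K.G.Adj q y → s(q, y) ≠ s(q, a') → s(q, y) ≠ s(b', q) →
        K.gauge g T q y = 1 := by
      intro y hy h1 h2
      obtain ⟨k, hkd, rfl⟩ := exists_fan ha hy
      have hT1 : k ≠ 0 → k ≠ i → T q (K.fan q a k) = 1 := by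
        intro h0 hki
        by_contra hne
        rcases hTr _ _ hy hne with h | h | h | h | h | h
        · exact fan_ne ha (by omega) hkd (Sym2.congr_right.1 h)
        · exact hki (fan_injOn ha hkd hid (Sym2.congr_right.1 h))
        · exact h1 h
        · exact h2 (h.trans Sym2.eq_swap)
        · exact hqP (Walk.fst_mem_support_of_mem_edges _ h)
        · exact hqN (Walk.fst_mem_support_of_mem_edges _ h)
      rw [gauge]
      rcases k.eq_zero_or_pos with rfl | h0
      · rw [hgin 0 hi, fan_zero, tri_fan_zero ha, hgout _ (by omega) (by omega), hprod]
        simp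
      rw [tri_fan_eq ha h0]
      rcases lt_trichotomy k i with hlt | rfl | hlt
      · rw [hgin k hlt, hgin (k - 1) (by omega), hT1 (by omega) (by omega)]
        simp
      · rw [hgout k le_rfl hkd, hgin (k - 1) (by omega)]
        simp
      · rw [hgout k hlt.le hkd, hgout (k - 1) (by omega) (by omega), hT1 (by omega) (by omega)]
        simp
    rintro x y hxy ⟨h1, ⟨h2, h3, h4⟩, h5⟩
    by_cases hx : x = q
    · subst hx; exact hq y hxy h1 h5
    by_cases hy : y = q
    · subst hy
      rw [hTg.inv hxy.symm, hq x hxy.symm (Sym2.eq_swap.trans_ne h1) (Sym2.eq_swap.trans_ne h5),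
        inv_one]
    have hgq : ∀ {x y}, K.G.Adj x y → x ≠ q → y ≠ q → s(x, y) ∉ L.edges → g (K.tri x y) = 1 := by
      intro x y hxy hx hy hL
      rw [← hg]
      refine if_neg ?_
      rintro ⟨k, hk, h⟩
      have hmem : q ∈ K.tri x y := by rw [h, mem_tri]; simp
      rw [mem_tri] at hmem
      have hnx : q = K.nx x y := (hmem.resolve_left (Ne.symm hx)).resolve_left (Ne.symm hy)
      rw [← tri_rot' hxy, ← hnx] at h
      have hqx : K.G.Adj q x := by rw [hnx]; exact (adj_nx' hxy).symm
      have hxk := tri_left_cancel hqx (fan_adj ha k) h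
      have hyk : y = K.fan q a (k + 1) := by
        rw [fan_succ, ← hxk, hnx, nx_nx' hxy]
      exact hL (hxk ▸ hyk ▸ hLe k hk)
    have hqe : q ∉ s(x, y) := by
      rw [Sym2.mem_iff]
      exact fun h => h.elim (Ne.symm hx) (Ne.symm hy)
    have hT1 : T x y = 1 := by
      by_contra hne
      rcases hTr _ _ hxy hne with h | h | h | h | h | h
      · exact hqe (h ▸ Sym2.mem_mk_left _ _)
      · exact hqe (h ▸ Sym2.mem_mk_left _ _)
      · exact hqe (h ▸ Sym2.mem_mk_left _ _)
      · exact hqe (h ▸ Sym2.mem_mk_left _ _)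
      · exact h2 h
      · exact h4 h
    rw [gauge, hT1, hgq hxy hx hy h3, hgq hxy.symm hy hx (Sym2.eq_swap.symm ▸ h3)]
    simp

end Corner

end OrientedTriangulation

namespace OrientedTriangulation

variable {V : Type*} [DecidableEq V] {F : Finset (Finset V)} {K : OrientedTriangulation F}
variable {a b q v : V} {S : Finset (Finset V)}

section Dual

theorem tri_inter_tri (h : K.G.Adj a b) : K.tri a b ∩ K.tri b a = {a, b} := by
  ext x
  rw [Finset.mem_inter, Finset.mem_insert, Finset.mem_singleton]
  constructor
  · rintro ⟨h1, h2⟩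
    rw [mem_tri] at h1
    rcases h1 with h1 | h1 | rfl
    · exact .inl h1
    · exact .inr h1
    · exact absurd h2 (nx_notMem_tri h.symm)
  · rintro (rfl | rfl) <;> simp [tri]

theorem exists_eq_tri_of_inter_mem {f g : Finset V} (hf : f ∈ F) (hg : g ∈ F) (hfg : f ≠ g)
    (h : f ∩ g ∈ edges F) : ∃ a b, K.G.Adj a b ∧ f = K.tri a b ∧ g = K.tri b a := by
  obtain ⟨a, b, hab, heq⟩ := exists_of_mem_edges (K := K) h
  have ha : a ∈ f ∩ g := by simp [heq]
  have hb : b ∈ f ∩ g := by simp [heq]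
  rw [Finset.mem_inter] at ha hb
  rcases eq_tri_or (K := K) hf ha.1 hb.1 hab.ne with rfl | rfl <;>
  rcases eq_tri_or (K := K) hg ha.2 hb.2 hab.ne with rfl | rfl
  · exact absurd rfl hfg
  · exact ⟨a, b, hab, rfl, rfl⟩
  · exact ⟨b, a, hab.symm, rfl, rfl⟩
  · exact absurd rfl hfg

theorem pair_mem_edges (h : K.G.Adj a b) : ({a, b} : Finset V) ∈ edges F := ((K.adj_iff a b).1 h).2

variable (K) in
/-- The faces are connected through the edges in `S`, in the sense that the sign functions which
do not change across `S` are constant. -/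
def DualConnected (S : Finset (Finset V)) : Prop :=
  ∀ X : Finset V → ℤˣ, (∀ a b, K.G.Adj a b → ({a, b} : Finset V) ∈ S →
    X (K.tri a b) = X (K.tri b a)) → ∀ f ∈ F, ∀ g ∈ F, X f = X g

variable (F) in
/-- The dual graph with the edges dual to `S`. -/
def dualGraph (S : Finset (Finset V)) : SimpleGraph {f // f ∈ F} where
  Adj f g := f ≠ g ∧ (f.1 ∩ g.1) ∈ S
  symm := ⟨fun f g h => ⟨h.1.symm, by rw [Finset.inter_comm]; exact h.2⟩⟩
  loopless := ⟨fun f h => h.1 rfl⟩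

theorem DualConnected.connected (h : K.DualConnected S) : (dualGraph F S).Connected := by
  classical
  obtain ⟨f₀, hf₀⟩ := K.closed.1
  rw [connected_iff_exists_forall_reachable]
  refine ⟨⟨f₀, hf₀⟩, fun ⟨g, hg⟩ => ?_⟩
  have := h (fun f => if ∃ hf : f ∈ F, (dualGraph F S).Reachable ⟨f₀, hf₀⟩ ⟨f, hf⟩ then 1 else -1)
    (fun a b hab hS => by
      have hadj : (dualGraph F S).Adj ⟨K.tri a b, tri_mem hab⟩ ⟨K.tri b a, tri_mem hab.symm⟩ :=
        ⟨fun h => tri_ne hab (congrArg Subtype.val h), by rwa [tri_inter_tri hab]⟩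
      congr 1
      exact propext ⟨fun ⟨_, h⟩ => ⟨tri_mem hab.symm, h.trans hadj.reachable⟩,
        fun ⟨_, h⟩ => ⟨tri_mem hab, h.trans hadj.symm.reachable⟩⟩) f₀ hf₀ g hg
  rw [if_pos ⟨hf₀, .refl _⟩] at this
  by_contra hcon
  rw [if_neg (fun ⟨_, h⟩ => hcon h)] at this
  exact absurd this (by decide)

theorem DualConnected.of_connected {H : SimpleGraph {f // f ∈ F}} (hH : H.Connected)
    (hS : ∀ f g, H.Adj f g → f.1 ∩ g.1 ∈ S) (hS' : S ⊆ edges F) : K.DualConnected S := by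
  intro X hX f hf g hg
  have := hH.preconnected ⟨f, hf⟩ ⟨g, hg⟩
  obtain ⟨w⟩ := this
  have key : ∀ {x y} (_ : H.Walk x y), X x.1 = X y.1 := by
    intro x y w
    induction w with
    | nil => rfl
    | cons h _ ih =>
      rw [← ih]
      have hm := hS _ _ h
      obtain ⟨a, b, hab, h1, h2⟩ := exists_eq_tri_of_inter_mem (K := K) (Subtype.prop _)
        (Subtype.prop _) (fun h' => h.ne (Subtype.ext h')) (hS' hm)
      rw [h1, h2] at hm ⊢
      rw [tri_inter_tri hab] at hm
      exact hX a b hab hm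
  exact key w

theorem dualConnected_edges (hF : FacesConnected F) : K.DualConnected (edges F) := by
  intro X hX f hf g hg
  have := hF f hf g hg
  clear hg
  induction this with
  | refl => rfl
  | tail _ h ih =>
    rename_i x y _
    rw [ih]
    by_cases hxy : x = y
    · rw [hxy]
    have hmem : x ∩ y ∈ edges F := by
      simp only [edges, Finset.mem_biUnion, Finset.mem_powersetCard]
      exact ⟨x, h.1, Finset.inter_subset_left, h.2.2⟩
    obtain ⟨a, b, hab, rfl, rfl⟩ := exists_eq_tri_of_inter_mem (K := K) h.1 h.2.1 hxy hmem
    exact hX a b hab (pair_mem_edges hab)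

/-- The edge separating two adjacent faces. -/
def dualEdge : Sym2 {f // f ∈ F} → Finset V :=
  Sym2.lift ⟨fun f g => f.1 ∩ g.1, fun _ _ => Finset.inter_comm _ _⟩

theorem dualEdge_injOn (K : OrientedTriangulation F) :
    Set.InjOn dualEdge (dualGraph F (edges F)).edgeSet := by
  intro e he e' he' h
  induction e with | _ f g => ?_
  induction e' with | _ f' g' => ?_
  obtain ⟨f, hf⟩ := f
  obtain ⟨g, hg⟩ := g
  obtain ⟨f', hf'⟩ := f'
  obtain ⟨g', hg'⟩ := g'
  rw [mem_edgeSet] at he he'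
  obtain ⟨a, b, hab, rfl, rfl⟩ := exists_eq_tri_of_inter_mem (K := K) hf hg
    (fun h => he.1 (Subtype.ext h)) he.2
  change _ ∩ _ = _ ∩ _ at h
  rw [tri_inter_tri hab] at h
  have ha : a ∈ f' ∩ g' := by rw [← h]; simp
  have hb : b ∈ f' ∩ g' := by rw [← h]; simp
  rw [Finset.mem_inter] at ha hb
  have hne : f' ≠ g' := fun h => he'.1 (Subtype.ext h)
  rcases eq_tri_or (K := K) hf' ha.1 hb.1 hab.ne with rfl | rfl <;>
  rcases eq_tri_or (K := K) hg' ha.2 hb.2 hab.ne with rfl | rfl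
  · exact absurd rfl hne
  · rfl
  · exact Sym2.eq_swap
  · exact absurd rfl hne

theorem DualConnected.card_le (h : K.DualConnected S) (hS : S ⊆ edges F) :
    F.card ≤ S.card + 1 := by
  have h1 := h.connected.card_vert_le_card_edgeSet_add_one
  have hle : dualGraph F S ≤ dualGraph F (edges F) := fun f g h => ⟨h.1, hS h.2⟩
  have h2 : Nat.card (dualGraph F S).edgeSet ≤ Nat.card S := by
    refine Nat.card_le_card_of_injective
      (fun e => (⟨dualEdge e.1, ?_⟩ : S)) ?_
    · obtain ⟨e, he⟩ := e
      induction e with | _ f g => exact he.2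
    · intro e e' h
      refine Subtype.ext (dualEdge_injOn K ?_ ?_ (congrArg Subtype.val h))
      · exact edgeSet_mono hle e.2
      · exact edgeSet_mono hle e'.2
  simp only [Nat.card_eq_fintype_card, Fintype.card_coe] at h1 h2
  omega

theorem exists_dualTree (hF : FacesConnected F) :
    ∃ S ⊆ edges F, K.DualConnected S ∧ S.card + 1 ≤ F.card := by
  classical
  obtain ⟨T, hT, htree⟩ := (dualConnected_edges (K := K) hF).connected.exists_isTree_le
  have hsub : T.edgeFinset.image dualEdge ⊆ edges F := by
    intro e he
    obtain ⟨e, he', rfl⟩ := Finset.mem_image.1 he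
    rw [mem_edgeFinset] at he'
    induction e with | _ f g => exact (hT he').2
  refine ⟨T.edgeFinset.image dualEdge, hsub, ?_, ?_⟩
  · refine .of_connected htree.connected (fun f g h => ?_) hsub
    exact Finset.mem_image.2 ⟨s(f, g), by rwa [mem_edgeFinset], rfl⟩
  · have := htree.card_edgeFinset
    have h2 := Finset.card_image_le (s := T.edgeFinset) (f := dualEdge)
    rw [Fintype.card_coe] at this
    omega

end Dual

section Boundary

variable (K) in
/-- A walk is a boundary if the edges that it uses an odd number of times bound a set of faces. -/
def IsBd {u v : V} (p : K.G.Walk u v) : Prop :=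
  ∃ X : Finset V → ℤˣ, ∀ a b, K.G.Adj a b → (-1) ^ p.edges.count s(a, b) = K.cob X a b

theorem cob_mul (X Y : Finset V → ℤˣ) : K.cob (X * Y) a b = K.cob X a b * K.cob Y a b := by
  simp only [cob, Pi.mul_apply]
  exact mul_mul_mul_comm _ _ _ _

theorem isBd_of_append {x y : V} {p₁ : K.G.Walk q x} {p₂ r : K.G.Walk x y} {p₃ : K.G.Walk y q}
    (h₁ : K.IsBd (p₁.append (r.append p₃))) (h₂ : K.IsBd (p₂.append r.reverse)) :
    K.IsBd (p₁.append (p₂.append p₃)) := by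
  obtain ⟨X, hX⟩ := h₁
  obtain ⟨Y, hY⟩ := h₂
  refine ⟨X * Y, fun a b h => ?_⟩
  rw [cob_mul, ← hX a b h, ← hY a b h]
  simp only [Walk.edges_append, List.count_append, Walk.edges_reverse, List.count_reverse, pow_add]
  have := Int.units_mul_self ((-1 : ℤˣ) ^ r.edges.count s(a, b))
  generalize ((-1 : ℤˣ) ^ r.edges.count s(a, b)) = t at *
  calc _ = (-1 : ℤˣ) ^ List.count s(a, b) p₁.edges * ((-1) ^ List.count s(a, b) p₂.edges *
        (-1) ^ List.count s(a, b) p₃.edges) * (t * t) := by rw [this, mul_one]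
    _ = _ := by ac_rfl

theorem vertices_finite_card_pos (K : OrientedTriangulation F) : 0 < (vertices F).card := by
  obtain ⟨f, hf⟩ := K.closed.1
  obtain ⟨v, hv⟩ := Finset.card_pos.1 (by rw [K.closed.2.1 f hf]; omega : 0 < f.card)
  exact Finset.card_pos.2 ⟨v, by simp only [vertices, Finset.mem_sup]; exact ⟨f, hf, hv⟩⟩

/-- A set of at least as many edges as there are vertices contains a cycle. -/
theorem exists_isCycle_of_card_le {R : Finset (Finset V)} (hR : R ⊆ edges F)
    (hcard : (vertices F).card ≤ R.card) :
    ∃ (q : V) (p : K.G.Walk q q), p.IsCycle ∧ ∀ a b, s(a, b) ∈ p.edges → {a, b} ∈ R := by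
  classical
  let H : SimpleGraph {v // v ∈ vertices F} :=
    { Adj := fun a b => a ≠ b ∧ ({a.1, b.1} : Finset V) ∈ R
      symm := ⟨fun a b h => ⟨h.1.symm, by rw [Finset.pair_comm]; exact h.2⟩⟩
      loopless := ⟨fun a h => h.1 rfl⟩ }
  have hcyc : ¬ H.IsAcyclic := by
    intro hac
    obtain ⟨v, hv⟩ := Finset.card_pos.1 (vertices_finite_card_pos K)
    have : Nonempty {v // v ∈ vertices F} := ⟨⟨v, hv⟩⟩
    obtain ⟨T, hHT, -, hT⟩ := (connected_top (V := {v // v ∈ vertices F})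
      ).exists_isTree_le_of_le_of_isAcyclic le_top hac
    have h1 := hT.card_edgeFinset
    have h2 : R.card ≤ T.edgeFinset.card := by
      refine Finset.card_le_card_of_surjOn (fun e => e.toFinset.image Subtype.val) ?_
      intro e he
      obtain ⟨a, b, hab, rfl⟩ := exists_of_mem_edges (K := K) (hR he)
      refine ⟨s(⟨a, mem_vertices_of_adj hab⟩, ⟨b, mem_vertices_of_adj hab.symm⟩), ?_, ?_⟩
      · rw [Finset.mem_coe, mem_edgeFinset, mem_edgeSet]
        exact hHT ⟨fun h => hab.ne (congrArg Subtype.val h), he⟩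
      · simp [Sym2.toFinset_mk_eq, Finset.image_insert]
    rw [Fintype.card_coe] at h1
    omega
  simp only [IsAcyclic, not_forall, not_not] at hcyc
  obtain ⟨q, c, hc⟩ := hcyc
  let φ : H →g K.G := ⟨Subtype.val, fun {a b} h => (K.adj_iff _ _).2
    ⟨fun h' => h.1 (Subtype.ext h'), hR h.2⟩⟩
  refine ⟨q.1, c.map φ, hc.map Subtype.val_injective, ?_⟩
  intro a b hab
  rw [Walk.edges_map, List.mem_map] at hab
  obtain ⟨e, he, heq⟩ := hab
  induction e with | _ x y => ?_
  have hxy := c.adj_of_mem_edges he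
  rw [Sym2.map_mk] at heq
  change s(x.1, y.1) = s(a, b) at heq
  have := hxy.2
  rwa [← Sym2.toFinset_mk_eq, heq, Sym2.toFinset_mk_eq] at this

theorem exists_not_isBd (hF : FacesConnected F) (hχ : eulerChar F = 0) :
    ∃ (q : V) (p : K.G.Walk q q), ¬ K.IsBd p := by
  obtain ⟨S, hS, hdual, hcard⟩ := exists_dualTree (K := K) hF
  have h1 := Finset.card_sdiff_add_card_eq_card hS
  rw [eulerChar] at hχ
  obtain ⟨q, p, hp, hpR⟩ := exists_isCycle_of_card_le (K := K) (R := edges F \ S)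
    Finset.sdiff_subset (by omega)
  refine ⟨q, p, fun ⟨X, hX⟩ => ?_⟩
  have hconst := hdual X fun a b hab hmem => by
    rw [← cob_eq_one_iff, ← hX a b hab, List.count_eq_zero_of_not_mem, pow_zero]
    exact fun h => (Finset.mem_sdiff.1 (hpR a b h)).2 hmem
  cases p with
  | nil => exact hp.ne_nil rfl
  | cons h p =>
    have h2 := hX _ _ h
    rw [List.count_eq_one_of_mem hp.isTrail.edges_nodup (by simp),
      (cob_eq_one_iff X).2 (hconst _ (tri_mem h) _ (tri_mem h.symm))] at h2
    exact absurd h2 (by decide)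

end Boundary

end OrientedTriangulation

theorem exists_append_of_not_isPath {V : Type*} [DecidableEq V] {G : SimpleGraph V} {u v : V}
    {p : G.Walk u v} (h : ¬ p.IsPath) :
    ∃ (x : V) (p₁ : G.Walk u x) (p₂ : G.Walk x x) (p₃ : G.Walk x v),
      p = p₁.append (p₂.append p₃) ∧ 0 < p₂.length := by
  induction p with
  | nil => simp at h
  | cons hadj p ih =>
    rename_i u c v
    by_cases hp : p.IsPath
    · have hu : u ∈ p.support := by
        by_contra hu
        exact h ((Walk.cons_isPath_iff _ _).2 ⟨hp, hu⟩)
      exact ⟨u, .nil, .cons hadj (p.takeUntil u hu), p.dropUntil u hu, by simp, by simp⟩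
    · obtain ⟨x, p₁, p₂, p₃, rfl, h2⟩ := ih hp
      exact ⟨x, .cons hadj p₁, p₂, p₃, by simp, h2⟩

theorem edges_eq_of_length_eq_one {V : Type*} {G : SimpleGraph V} {u v : V} {p : G.Walk u v}
    (h : p.length = 1) : p.edges = [s(u, v)] := by
  cases p with
  | nil => simp at h
  | cons _ p =>
    cases p with
    | nil => simp
    | cons => simp at h

theorem IsPath.edges_eq_of_mem {V : Type*} {G : SimpleGraph V} {u v : V} {p : G.Walk u v}
    (hp : p.IsPath) (h : s(u, v) ∈ p.edges) : p.edges = [s(u, v)] := by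
  cases p with
  | nil => simp at h
  | cons hadj p =>
    rename_i c
    rw [Walk.cons_isPath_iff] at hp
    rw [Walk.edges_cons, List.mem_cons] at h
    rcases h with h | h
    · obtain rfl := Sym2.congr_right.1 h
      have := Walk.isPath_iff_nil.1 hp.1
      simp [Walk.edges_eq_nil.2 this]
    · exact absurd (p.fst_mem_support_of_mem_edges h) hp.2

namespace OrientedTriangulation

variable {V : Type*} [DecidableEq V] {F : Finset (Finset V)} {K : OrientedTriangulation F}
variable {a b q v : V}

section MinimalCycle

variable (K) in
/-- A closed walk that is not a boundary, of minimal length. -/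
def IsMinimal (p : K.G.Walk q q) : Prop :=
  ¬ K.IsBd p ∧ ∀ (q' : V) (p' : K.G.Walk q' q'), p'.length < p.length → K.IsBd p'

theorem exists_isMinimal (h : ∃ (q : V) (p : K.G.Walk q q), ¬ K.IsBd p) :
    ∃ (q : V) (p : K.G.Walk q q), K.IsMinimal p := by
  classical
  have h' : ∃ n, ∃ (q : V) (p : K.G.Walk q q), p.length = n ∧ ¬ K.IsBd p := by
    obtain ⟨q, p, hp⟩ := h
    exact ⟨_, q, p, rfl, hp⟩
  obtain ⟨q, p, hl, hp⟩ := Nat.find_spec h'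
  refine ⟨q, p, hp, fun q' p' hlt => ?_⟩
  by_contra hb
  exact Nat.find_min h' (hl ▸ hlt) ⟨q', p', rfl, hb⟩

theorem IsMinimal.le_length {x y : V} {p₁ : K.G.Walk q x} {p₂ : K.G.Walk x y}
    {p₃ : K.G.Walk y q} (h : K.IsMinimal (p₁.append (p₂.append p₃))) (r : K.G.Walk x y) :
    p₂.length ≤ r.length ∨ p₁.length + p₃.length ≤ r.length := by
  by_contra! hcon
  refine h.1 (isBd_of_append (r := r) (h.2 _ _ ?_) (h.2 _ _ ?_)) <;>
  simp only [Walk.length_append, Walk.length_reverse] <;> omega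

theorem IsMinimal.mem_edges_of_append {x y : V} {p₁ : K.G.Walk q x} {p₂ : K.G.Walk x y}
    {p₃ : K.G.Walk y q} (h : K.IsMinimal (p₁.append (p₂.append p₃))) (hxy : K.G.Adj x y) :
    s(x, y) ∈ (p₁.append (p₂.append p₃)).edges := by
  have h1 : p₂.length ≠ 0 := fun h => hxy.ne (Walk.eq_of_length_eq_zero h)
  have h2 : p₁.length = 0 → p₃.length = 0 → False := fun h1 h3 =>
    hxy.ne ((Walk.eq_of_length_eq_zero h1).symm.trans (Walk.eq_of_length_eq_zero h3).symm)
  simp only [Walk.edges_append, List.mem_append]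
  rcases h.le_length (.cons hxy .nil) with h' | h' <;>
  simp only [Walk.length_cons, Walk.length_nil, zero_add] at h'
  · right; left
    rw [edges_eq_of_length_eq_one (p := p₂) (by omega)]
    simp
  · rcases Nat.eq_zero_or_pos p₁.length with h0 | h0
    · have : p₃.length ≠ 0 := h2 h0
      right; right
      rw [edges_eq_of_length_eq_one (p := p₃) (by omega), Walk.eq_of_length_eq_zero h0,
        Sym2.eq_swap]
      simp
    · left
      have h3 : p₃.length = 0 := by omega
      rw [edges_eq_of_length_eq_one (p := p₁) (by omega), ← Walk.eq_of_length_eq_zero h3,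
        Sym2.eq_swap]
      simp

theorem IsMinimal.mem_edges {p : K.G.Walk q q} (h : K.IsMinimal p) {x y : V} (hx : x ∈ p.support)
    (hy : y ∈ p.support) (hxy : K.G.Adj x y) : s(x, y) ∈ p.edges := by
  have hp := p.take_spec hx
  have hy' := hy
  rw [← hp, Walk.mem_support_append_iff] at hy'
  rcases hy' with hy' | hy'
  · have h1 := (p.takeUntil x hx).take_spec hy'
    rw [← h1, ← Walk.append_assoc] at hp
    rw [← hp] at h ⊢
    rw [Sym2.eq_swap]
    exact h.mem_edges_of_append hxy.symm
  · have h1 := (p.dropUntil x hx).take_spec hy'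
    rw [← h1] at hp
    rw [← hp] at h ⊢
    exact h.mem_edges_of_append hxy

variable (K) in
/-- An induced simple closed curve that does not bound, with a marked vertex `q` and its two
neighbours `a` and `b` on the curve. -/
structure EssentialCycle where
  (q a b : V)
  P : K.G.Walk a b
  adj_a : K.G.Adj q a
  adj_b : K.G.Adj b q
  isPath : P.IsPath
  q_notMem : q ∉ P.support
  ne : a ≠ b
  induced : ∀ x y, (x = q ∨ x ∈ P.support) → (y = q ∨ y ∈ P.support) → K.G.Adj x y →
    s(x, y) = s(q, a) ∨ s(x, y) = s(b, q) ∨ s(x, y) ∈ P.edges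
  not_bd : ∀ X : Finset V → ℤˣ, ¬ ∀ x y, K.G.Adj x y →
    (K.cob X x y = -1 ↔ s(x, y) = s(q, a) ∨ s(x, y) = s(b, q) ∨ s(x, y) ∈ P.edges)

theorem not_isBd_ne {P : K.G.Walk a b} (hP : P.IsPath) (ha : K.G.Adj q a) (hb : K.G.Adj b q)
    (h : ¬ K.IsBd (.cons ha (P.concat hb))) : a ≠ b := by
  rintro rfl
  obtain rfl := Walk.eq_nil_iff_nil.2 (Walk.isPath_iff_nil.1 hP)
  refine h ⟨fun _ => 1, fun x y _ => ?_⟩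
  have : (Walk.cons ha ((Walk.nil : K.G.Walk a a).concat hb)).edges = [s(q, a), s(q, a)] := by
    simp [Walk.concat_eq_append, Sym2.eq_swap]
  rw [this]
  by_cases hxy : s(q, a) = s(x, y) <;> simp [hxy, cob]

theorem exists_essentialCycle (hF : FacesConnected F) (hχ : eulerChar F = 0) :
    Nonempty K.EssentialCycle := by
  obtain ⟨q, p, hp⟩ := exists_isMinimal (K := K) (exists_not_isBd hF hχ)
  cases p with
  | nil => exact absurd ⟨fun _ => 1, by simp [cob]⟩ hp.1
  | cons ha p =>
    rename_i a
    have hpath : p.IsPath := by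
      by_contra hnp
      obtain ⟨x, p₁, p₂, p₃, rfl, h2⟩ := exists_append_of_not_isPath hnp
      rw [← Walk.cons_append] at hp
      have := hp.le_length .nil
      simp only [Walk.length_nil, Walk.length_cons] at this
      omega
    obtain ⟨b, P, hb, rfl⟩ : ∃ (b : V) (P : K.G.Walk a b) (hb : K.G.Adj b q), p = P.concat hb := by
      cases p with
      | nil => exact absurd rfl ha.ne
      | cons h p =>
        obtain ⟨b, P, hb, h⟩ := Walk.exists_cons_eq_concat h p
        exact ⟨b, P, hb, h⟩
    rw [Walk.concat_isPath_iff] at hpath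
    have hne := not_isBd_ne hpath.1 ha hb hp.1
    have hmem : ∀ e, e ∈ (Walk.cons ha (P.concat hb)).edges ↔
        e = s(q, a) ∨ e = s(b, q) ∨ e ∈ P.edges := by
      intro e
      simp only [Walk.edges_cons, Walk.edges_concat, List.concat_eq_append, List.mem_cons,
        List.mem_append, List.not_mem_nil, or_false]
      tauto
    have hsupp : ∀ x, x = q ∨ x ∈ P.support → x ∈ (Walk.cons ha (P.concat hb)).support := by
      rintro x (rfl | hx)
      · simp
      · simp [Walk.support_concat, hx]
    have hnodup : (Walk.cons ha (P.concat hb)).edges.Nodup := by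
      simp only [Walk.edges_cons, Walk.edges_concat, List.concat_eq_append, List.nodup_cons,
        List.mem_append, List.mem_singleton, not_or]
      refine ⟨⟨fun h => hpath.2 (P.fst_mem_support_of_mem_edges h), fun h => hne ?_⟩, ?_⟩
      · rw [Sym2.eq_swap] at h
        exact Sym2.congr_left.1 h
      · rw [List.nodup_append]
        refine ⟨hpath.1.isTrail.edges_nodup, by simp, ?_⟩
        rintro e he e' he' rfl
        rw [List.mem_singleton] at he'
        subst he'
        exact hpath.2 (P.snd_mem_support_of_mem_edges he)
    refine ⟨⟨q, a, b, P, ha, hb, hpath.1, hpath.2, hne, ?_, ?_⟩⟩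
    · intro x y hx hy hxy
      rw [← hmem]
      exact hp.mem_edges (hsupp x hx) (hsupp y hy) hxy
    · intro X hX
      refine hp.1 ⟨X, fun x y hxy => ?_⟩
      have h := hX x y hxy
      rw [← hmem] at h
      by_cases he : s(x, y) ∈ (Walk.cons ha (P.concat hb)).edges
      · rw [List.count_eq_one_of_mem hnodup he, h.2 he, pow_one]
      · rw [List.count_eq_zero_of_not_mem he, pow_zero]
        exact ((Int.units_eq_one_or _).resolve_right (fun h' => he (h.1 h'))).symm

end MinimalCycle

end OrientedTriangulation

theorem dart_induction {V : Type*} {G : SimpleGraph V} {a b : V} {P : G.Walk a b} (hP : P.IsPath)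
    {x z : V} (hx : G.Adj x a) (hz : G.Adj b z) (hxP : x ∉ P.support) (hzP : z ∉ P.support)
    (hxz : x = z → a ≠ b) {E : Set (Sym2 V)}
    (hE : ∀ v ∈ P.support, ∀ t, s(v, t) ∈ E → s(v, t) = s(x, a) ∨ s(v, t) = s(b, z) ∨
      s(v, t) ∈ P.edges) {ψ : V → V → Prop}
    (step : ∀ u v w, v ∈ P.support → (u = x ∨ u ∈ P.support) → (w = z ∨ w ∈ P.support) → u ≠ w →
      G.Adj u v → G.Adj v w → (∀ t, s(v, t) ∈ E → t = u ∨ t = w) → ψ u v → ψ v w) (h : ψ x a) :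
    ψ b z ∧ ∀ d ∈ P.darts, ψ d.fst d.snd := by
  induction P generalizing x with
  | nil =>
    refine ⟨step _ _ _ (by simp) (.inl rfl) (.inl rfl) (fun h => hxz h rfl) hx hz
      (fun t ht => ?_) h, by simp⟩
    rcases hE _ (by simp) t ht with h | h | h
    · rw [Sym2.eq_swap] at h; exact .inl (Sym2.congr_left.1 h)
    · exact .inr (Sym2.congr_right.1 h)
    · simp at h
  | cons hadj P ih =>
    rename_i a c b
    rw [Walk.cons_isPath_iff] at hP
    rw [Walk.support_cons, List.mem_cons, not_or] at hxP hzP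
    have hxc : x ≠ c := fun h => hxP.2 (h ▸ P.start_mem_support)
    have h1 : ψ a c := by
      refine step x a c (by simp) (.inl rfl) (by simp) hxc hx hadj (fun t ht => ?_) h
      rcases hE a (by simp) t ht with h | h | h
      · rw [Sym2.eq_swap] at h; exact .inl (Sym2.congr_left.1 h)
      · have : a ∈ s(b, z) := h ▸ Sym2.mem_mk_left _ _
        rcases Sym2.mem_iff.1 this with h' | h'
        · exact absurd (h' ▸ P.end_mem_support) hP.2
        · exact absurd h'.symm hzP.1
      · rw [Walk.edges_cons, List.mem_cons] at h
        rcases h with h | h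
        · exact .inr (Sym2.congr_right.1 h)
        · exact absurd (P.fst_mem_support_of_mem_edges h) hP.2
    have h2 := ih hP.1 hadj hz hP.2 hzP.2 (fun h => absurd h.symm hzP.1) (fun v hv t ht => ?_)
      (fun u v w hv hu hw => step u v w (by simp [hv])
        (.inr (by rcases hu with rfl | hu <;> simp [*])) (hw.imp_right (by simp +contextual))) h1
    · refine ⟨h2.1, fun d hd => ?_⟩
      rw [Walk.darts_cons, List.mem_cons] at hd
      rcases hd with rfl | hd
      · exact h1
      · exact h2.2 d hd
    · rcases hE v (by simp [hv]) t ht with h | h | h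
      · have : v ∈ s(x, a) := h ▸ Sym2.mem_mk_left _ _
        rcases Sym2.mem_iff.1 this with h' | h'
        · exact absurd (h' ▸ hv) hxP.2
        · exact absurd (h' ▸ hv) hP.2
      · exact .inr (.inl h)
      · rw [Walk.edges_cons, List.mem_cons] at h
        rcases h with h | h
        · exact .inl h
        · exact .inr (.inr h)

/-- A walk starting in `S` contains a path from the last visit to `S`. -/
theorem exists_path_from_last {V : Type*} [DecidableEq V] {G : SimpleGraph V} (S : Set V) {u z : V}
    (w : G.Walk u z) (h : ∃ x ∈ w.support, x ∈ S) :
    ∃ y ∈ S, ∃ N : G.Walk y z, N.IsPath ∧ (∀ x ∈ N.support, x ∈ w.support) ∧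
      ∀ x ∈ N.support, x ∈ S → x = y := by
  induction w with
  | nil =>
    obtain ⟨x, hx, hxS⟩ := h
    obtain rfl : x = _ := by simpa using hx
    exact ⟨x, hxS, .nil, by simp, by simp, by simp⟩
  | cons hadj w ih =>
    rename_i u c z
    by_cases hw : ∃ x ∈ w.support, x ∈ S
    · obtain ⟨y, hy, N, h1, h2, h3⟩ := ih hw
      exact ⟨y, hy, N, h1, fun x hx => by simp [h2 x hx], h3⟩
    · push Not at hw
      obtain ⟨x, hx, hxS⟩ := h
      have key : ∀ x ∈ (Walk.cons hadj w).support, x ∈ S → x = u := by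
        intro x hx hxS
        rw [Walk.support_cons, List.mem_cons] at hx
        exact hx.resolve_right fun h => hw x h hxS
      obtain rfl := key x hx hxS
      exact ⟨x, hxS, (Walk.cons hadj w).bypass, Walk.bypass_isPath _,
        fun y hy => Walk.support_bypass_subset_support _ hy,
        fun y hy => key y (Walk.support_bypass_subset_support _ hy)⟩

theorem exists_dart_of_mem_edges {V : Type*} {G : SimpleGraph V} {a b u v : V} {P : G.Walk a b}
    (h : s(u, v) ∈ P.edges) :
    ∃ d ∈ P.darts, (d.fst = u ∧ d.snd = v) ∨ (d.fst = v ∧ d.snd = u) := by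
  rw [Walk.edges, List.mem_map] at h
  obtain ⟨d, hd, h⟩ := h
  refine ⟨d, hd, ?_⟩
  exact Sym2.eq_iff.1 h

namespace OrientedTriangulation

variable {V : Type*} [DecidableEq V] {F : Finset (Finset V)} {K : OrientedTriangulation F}
variable {a b q u v w : V}

section Propagation

theorem IsFlat.dart_constant {M : Type*} [Group M] {T : V → V → M} (hT : K.IsFlat T)
    {P : K.G.Walk a b} (hP : P.IsPath)
    (ha : K.G.Adj q a) (hb : K.G.Adj b q) (hqP : q ∉ P.support) (hab : a ≠ b)
    (hE : ∀ v ∈ P.support, ∀ t, K.G.Adj v t → T v t ≠ 1 →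
      s(v, t) = s(q, a) ∨ s(v, t) = s(b, q) ∨ s(v, t) ∈ P.edges) :
    T b q = T q a ∧ ∀ d ∈ P.darts, T d.fst d.snd = T q a := by
  refine dart_induction hP ha hb hqP hqP (fun _ => hab) (ψ := fun u v => T u v = T q a)
    (E := {e | ∃ v ∈ P.support, ∃ t, e = s(v, t) ∧ K.G.Adj v t ∧ T v t ≠ 1}) ?_ ?_ rfl
  · rintro v - t ⟨v', hv', t', heq, hadj, hne⟩
    rw [heq]
    exact hE v' hv' t' hadj hne
  · intro u v w hv _ _ huw huv hvw ht h
    rw [← h]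
    have := hT.mul_eq_one huv.symm hvw huw fun c hc hcu hcw => by
      by_contra hne
      exact (ht c ⟨v, hv, c, rfl, hc, hne⟩).elim hcu hcw
    rw [mul_eq_one_iff_eq_inv.1 this, hT.inv huv, inv_inv]

theorem cob_fan (X : Finset V → ℤˣ) (h : K.G.Adj v a) (k : ℕ) :
    X (K.tri v (K.fan v a (k + 1))) =
      K.cob X v (K.fan v a (k + 1)) * X (K.tri v (K.fan v a k)) := by
  rw [cob, tri_fan_succ h, mul_assoc, Int.units_mul_self, mul_one]

theorem tri_fan_constant (X : Finset V → ℤˣ) (h : K.G.Adj v a) {m n : ℕ} (hmn : m ≤ n)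
    (hX : ∀ j, m < j → j ≤ n → K.cob X v (K.fan v a j) = 1) :
    X (K.tri v (K.fan v a n)) = X (K.tri v (K.fan v a m)) := by
  induction n, hmn using Nat.le_induction with
  | base => rfl
  | succ n hmn ih =>
    rw [cob_fan X h, hX _ (by omega) le_rfl, one_mul, ih fun j h1 h2 => hX j h1 (by omega)]

theorem tri_left_constant (X : Finset V → ℤˣ) (huv : K.G.Adj u v) (hvw : K.G.Adj v w) (huw : u ≠ w)
    (hX : ∀ t, K.G.Adj v t → t ≠ u → t ≠ w → K.cob X v t = 1) :
    X (K.tri v w) = X (K.tri u v) := by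
  obtain ⟨k, hk, rfl⟩ := exists_fan hvw huv.symm
  have h0 : 0 < k := Nat.pos_of_ne_zero fun h => huw (by rw [h, fan_zero])
  rw [tri_fan_eq hvw h0, tri_fan_constant X hvw (Nat.zero_le (k - 1)), fan_zero]
  intro j h1 h2
  exact hX _ (fan_adj hvw j) (fun h => by have := fan_injOn hvw (by omega) hk h; omega)
    (fan_ne hvw h1 (by omega))

/-- If a set of vertices avoiding `Q` is closed under adjacency outside `Q`, then it can be
followed along the left side of `Q`. -/
theorem nx_mem_of_nx_mem {A Q : Set V} (hAQ : ∀ x ∈ A, x ∉ Q)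
    (hA : ∀ x ∈ A, ∀ y, K.G.Adj x y → y ∉ Q → y ∈ A) (huv : K.G.Adj u v) (hvw : K.G.Adj v w)
    (huw : u ≠ w)
    (hw : w ∈ Q) (hQ : ∀ t ∈ Q, K.G.Adj v t → t = u ∨ t = w)
    (h : K.nx u v ∈ A) : K.nx v w ∈ A := by
  obtain ⟨k, hk, rfl⟩ := exists_fan hvw huv.symm
  have key : ∀ j, j < k → 0 < j ∧ (K.fan v w j ∈ A) → ∀ i, 0 < i → i ≤ j → K.fan v w i ∈ A := by
    intro j hjk
    induction j with
    | zero => intro h; omega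
    | succ j ih =>
      rintro ⟨-, hj⟩ i hi hij
      rcases hij.eq_or_lt with rfl | hlt
      · exact hj
      refine ih (by omega) ⟨by omega, ?_⟩ i hi (by omega)
      refine hA _ hj _ ?_ ?_
      · rw [fan_succ]; exact (K.adj_nx (fan_adj hvw j)).symm
      · intro hmem
        rcases hQ _ hmem (fan_adj hvw j) with h | h
        · have := fan_injOn hvw (by omega) hk h
          omega
        · exact fan_ne hvw (by omega) (by omega) h
  rcases k.eq_zero_or_pos with rfl | h0
  · exact absurd rfl huw
  obtain ⟨k, rfl⟩ : ∃ m, k = m + 1 := ⟨k - 1, by omega⟩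
  have hnx : K.nx (K.fan v w (k + 1)) v = K.fan v w k := by
    rw [fan_succ, nx_nx' (fan_adj hvw k)]
  rw [hnx] at h
  have hk0 : 0 < k := Nat.pos_of_ne_zero fun h0 => by
    rw [h0, fan_zero] at h
    exact hAQ _ h hw
  exact key k (by omega) ⟨hk0, h⟩ 1 one_pos hk0

/-- The edges of the closed curve formed by a walk and a further vertex. -/
def arc {G : SimpleGraph V} (q : V) {a b : V} (P : G.Walk a b) : Set (Sym2 V) :=
  {e | e = s(q, a) ∨ e = s(b, q) ∨ e ∈ P.edges}

theorem IsFlat.eq_or_of_mem_arc {M : Type*} [Group M] {T : V → V → M} (hT : K.IsFlat T)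
    {P : K.G.Walk a b} (hP : P.IsPath)
    (ha : K.G.Adj q a) (hb : K.G.Adj b q) (hqP : q ∉ P.support) (hab : a ≠ b)
    (hE : ∀ v ∈ P.support, ∀ t, K.G.Adj v t → T v t ≠ 1 → s(v, t) ∈ arc q P)
    (h : s(u, v) ∈ arc q P) : T u v = T q a ∨ T u v = (T q a)⁻¹ := by
  obtain ⟨h1, h2⟩ := hT.dart_constant hP ha hb hqP hab hE
  rcases h with h | h | h
  · rcases Sym2.eq_iff.1 h with ⟨rfl, rfl⟩ | ⟨rfl, rfl⟩
    · exact .inl rfl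
    · exact .inr (hT.inv ha)
  · rcases Sym2.eq_iff.1 h with ⟨rfl, rfl⟩ | ⟨rfl, rfl⟩
    · exact .inl h1
    · exact .inr (by rw [hT.inv hb, h1])
  · obtain ⟨d, hd, ⟨rfl, rfl⟩ | ⟨rfl, rfl⟩⟩ := exists_dart_of_mem_edges h
    · exact .inl (h2 d hd)
    · exact .inr (by rw [hT.inv d.adj, h2 d hd])

end Propagation

end OrientedTriangulation

namespace OrientedTriangulation

variable {V : Type*} [DecidableEq V] {F : Finset (Finset V)} {K : OrientedTriangulation F}
variable {a b q u v w x y : V}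

theorem eq_one_of_ne_neg_one {s : ℤˣ} (h : s ≠ -1) : s = 1 :=
  (Int.units_eq_one_or s).resolve_right h

theorem mem_verts_of_mem_arc {P : K.G.Walk a b} (h : s(x, y) ∈ arc q P) :
    x = q ∨ x ∈ P.support := by
  rcases h with h | h | h
  · rcases Sym2.eq_iff.1 h with ⟨rfl, -⟩ | ⟨rfl, -⟩
    · exact .inl rfl
    · exact .inr P.start_mem_support
  · rcases Sym2.eq_iff.1 h with ⟨rfl, -⟩ | ⟨rfl, -⟩
    · exact .inr P.end_mem_support
    · exact .inl rfl
  · exact .inr (P.fst_mem_support_of_mem_edges h)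

theorem notMem_arc_of_notMem {P : K.G.Walk a b} (hx : x ≠ q) (hP : x ∉ P.support) :
    s(x, y) ∉ arc q P := fun h =>
  (mem_verts_of_mem_arc h).elim hx hP

theorem eq_or_eq_of_mem_arc {P : K.G.Walk a b} (hP : q ∉ P.support) (h : s(q, x) ∈ arc q P) :
    x = a ∨ x = b := by
  rcases h with h | h | h
  · exact .inl (Sym2.congr_right.1 h)
  · rw [Sym2.eq_swap (a := b)] at h
    exact .inr (Sym2.congr_right.1 h)
  · exact absurd (P.fst_mem_support_of_mem_edges h) hP

namespace EssentialCycle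

variable (C : K.EssentialCycle)

/-- The vertices of the curve. -/
def verts : Set V := {x | x = C.q ∨ x ∈ C.P.support}

variable {C}

theorem mem_arc (hx : x ∈ C.verts) (hy : y ∈ C.verts) (h : K.G.Adj x y) :
    s(x, y) ∈ arc C.q C.P := C.induced x y hx hy h

theorem eq_or_of_adj (hx : x ∈ C.verts) (h : K.G.Adj C.q x) : x = C.a ∨ x = C.b :=
  eq_or_eq_of_mem_arc C.q_notMem (mem_arc (.inl rfl) hx h)

theorem nx_notMem : K.nx C.q C.a ∉ C.verts := by
  intro hmem
  have hb : K.nx C.q C.a = C.b := (eq_or_of_adj hmem (adj_nx' C.adj_a)).resolve_left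
    (K.adj_nx C.adj_a).ne'
  have hab : K.G.Adj C.a C.b := hb ▸ K.adj_nx C.adj_a
  have hP : C.P.edges = [s(C.a, C.b)] := by
    rcases mem_arc (.inr C.P.start_mem_support) (.inr C.P.end_mem_support) hab with h | h | h
    · rw [Sym2.eq_swap] at h
      exact absurd (Sym2.congr_left.1 h) C.adj_b.ne
    · rw [Sym2.eq_swap] at h
      exact absurd (Sym2.congr_right.1 h) C.adj_a.ne'
    · exact IsPath.edges_eq_of_mem C.isPath h
  have hf : K.tri C.q C.a = {C.q, C.a, C.b} := by rw [tri, hb]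
  have hfF := tri_mem C.adj_a
  refine C.not_bd (fun f => if f = K.tri C.q C.a then -1 else 1) fun x y hxy => ?_
  have h1 : K.cob (fun f => if f = K.tri C.q C.a then -1 else 1) x y = -1 ↔
      x ∈ K.tri C.q C.a ∧ y ∈ K.tri C.q C.a := by
    constructor
    · intro h
      rw [cob] at h
      split_ifs at h with h1 h2 h2
      · simp at h
      · rw [← h1]; simp [tri]
      · rw [← h2]; simp [tri]
      · simp at h
    · rintro ⟨h1, h2⟩
      rcases eq_tri_or (K := K) hfF h1 h2 hxy.ne with h | h <;> rw [h, cob]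
      · rw [if_pos rfl, if_neg (tri_ne hxy).symm, mul_one]
      · rw [if_pos rfl, if_neg (tri_ne hxy), one_mul]
  rw [h1, hf, hP]
  have := hxy.ne
  simp only [Finset.mem_insert, Finset.mem_singleton, List.mem_singleton, Sym2.eq_iff]
  grind

variable (C) in
/-- The vertices on the left side of the curve near the marked vertex. -/
def leftSide : Set V := {x | ∃ w : K.G.Walk (K.nx C.q C.a) x, ∀ y ∈ w.support, y ∉ C.verts}

theorem notMem_verts (h : x ∈ C.leftSide) : x ∉ C.verts := by
  obtain ⟨w, hw⟩ := h
  exact hw _ w.end_mem_support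

theorem mem_leftSide_of_adj (h : x ∈ C.leftSide) (hxy : K.G.Adj x y) (hy : y ∉ C.verts) :
    y ∈ C.leftSide := by
  obtain ⟨w, hw⟩ := h
  refine ⟨w.concat hxy, fun z hz => ?_⟩
  rw [Walk.support_concat, List.mem_append, List.mem_singleton] at hz
  rcases hz with hz | rfl
  · exact hw z hz
  · exact hy

theorem exists_mem_leftSide_iff {f : Finset V} (hf : f ∈ F) (hxf : x ∈ f) (hx : x ∉ C.verts) :
    (∃ z ∈ f, z ∈ C.leftSide) ↔ x ∈ C.leftSide := by
  refine ⟨fun ⟨z, hz, h⟩ => ?_, fun h => ⟨x, hxf, h⟩⟩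
  by_cases hzx : z = x
  · exact hzx ▸ h
  · exact mem_leftSide_of_adj h (adj_iff_exists.2 ⟨hzx, f, hf, hz, hxf⟩) hx

/-- A property of the darts of the curve that propagates along the curve holds for all darts. -/
theorem dart_induction {ψ : V → V → Prop}
    (step : ∀ u v w, u ∈ C.verts → v ∈ C.P.support → w ∈ C.verts → u ≠ w → K.G.Adj u v →
    K.G.Adj v w →   (∀ t ∈ C.verts, K.G.Adj v t → t = u ∨ t = w) → ψ u v → ψ v w) (h : ψ C.q C.a) :
    ψ C.b C.q ∧ ∀ x y, s(x, y) ∈ arc C.q C.P → ψ x y ∨ ψ y x := by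
  obtain ⟨h1, h2⟩ := Fisk.dart_induction C.isPath C.adj_a C.adj_b C.q_notMem C.q_notMem
    (fun _ => C.ne) (E := {e | ∀ x ∈ e, x ∈ C.verts} ∩ K.G.edgeSet) (ψ := ψ)
    (fun v hv t ht => mem_arc (.inr hv) (ht.1 t (Sym2.mem_mk_right _ _)) ht.2)
    (fun u v w hv hu hw huw huv hvw ht => step u v w hu hv hw huw huv hvw
      fun t ht' hvt => ht t ⟨by
        intro x hx
        rcases Sym2.mem_iff.1 hx with rfl | rfl
        · exact .inr hv
        · exact ht', hvt⟩) h
  refine ⟨h1, ?_⟩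
  rintro x y (hxy | hxy | hxy)
  · rcases Sym2.eq_iff.1 hxy with ⟨rfl, rfl⟩ | ⟨rfl, rfl⟩
    · exact .inl h
    · exact .inr h
  · rcases Sym2.eq_iff.1 hxy with ⟨rfl, rfl⟩ | ⟨rfl, rfl⟩
    · exact .inl h1
    · exact .inr h1
  · obtain ⟨d, hd, ⟨rfl, rfl⟩ | ⟨rfl, rfl⟩⟩ := exists_dart_of_mem_edges hxy
    · exact .inl (h2 d hd)
    · exact .inr (h2 d hd)

theorem nx_mem_leftSide : K.nx C.a C.q ∈ C.leftSide := by
  classical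
  by_contra hcon
  have key : ∀ x y, s(x, y) ∈ arc C.q C.P →
      (K.nx x y ∈ C.leftSide ∧ K.nx y x ∉ C.leftSide) ∨
      (K.nx y x ∈ C.leftSide ∧ K.nx x y ∉ C.leftSide) := by
    refine (dart_induction (ψ := fun x y => K.nx x y ∈ C.leftSide ∧ K.nx y x ∉ C.leftSide)
      (fun u v w hu _ hw huw huv hvw ht h => ⟨?_, fun h' => h.2 ?_⟩)
      ⟨⟨.nil, by simpa using nx_notMem⟩, hcon⟩).2
    · exact nx_mem_of_nx_mem (fun _ => notMem_verts) (fun _ h _ => mem_leftSide_of_adj h)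
        huv hvw huw hw ht h.1
    · exact nx_mem_of_nx_mem (fun _ => notMem_verts) (fun _ h _ => mem_leftSide_of_adj h)
        hvw.symm huv.symm huw.symm hu (fun t h1 h2 => (ht t h1 h2).symm) h'
  have htri : ∀ x y, s(x, y) ∈ arc C.q C.P →
      ((∃ z ∈ K.tri x y, z ∈ C.leftSide) ↔ K.nx x y ∈ C.leftSide) := by
    intro x y h
    have hx : x ∉ C.leftSide := fun h' => notMem_verts h' (mem_verts_of_mem_arc h)
    have hy : y ∉ C.leftSide := fun h' => notMem_verts h' (mem_verts_of_mem_arc (Sym2.eq_swap ▸ h))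
    simp [tri, hx, hy]
  refine C.not_bd (fun f => if ∃ z ∈ f, z ∈ C.leftSide then -1 else 1) fun x y hxy => ?_
  rw [cob]
  constructor
  · intro h
    by_contra hn
    have : ¬ (x ∈ C.verts ∧ y ∈ C.verts) := fun h => hn (mem_arc h.1 h.2 hxy)
    have heq : (∃ z ∈ K.tri x y, z ∈ C.leftSide) ↔ (∃ z ∈ K.tri y x, z ∈ C.leftSide) := by
      rcases not_and_or.1 this with hx | hx
      · rw [exists_mem_leftSide_iff (tri_mem hxy) (by simp [tri]) hx,
          exists_mem_leftSide_iff (tri_mem hxy.symm) (by simp [tri]) hx]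
      · rw [exists_mem_leftSide_iff (tri_mem hxy) (by simp [tri]) hx,
          exists_mem_leftSide_iff (tri_mem hxy.symm) (by simp [tri]) hx]
    simp only [heq, Int.units_mul_self] at h
    exact absurd h (by decide)
  · intro h
    change s(x, y) ∈ arc C.q C.P at h
    simp only [htri x y h, htri y x (Sym2.eq_swap ▸ h)]
    rcases key x y h with ⟨h1, h2⟩ | ⟨h1, h2⟩ <;> simp [h1, h2]

end EssentialCycle

variable (K) in
/-- Two arcs from a vertex `q` back to `q` that meet only at `q` and cross there, and whose union
does not disconnect the surface. -/
structure Crossing where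
  (q a b y z : V)
  P : K.G.Walk a b
  N : K.G.Walk y z
  adj_a : K.G.Adj q a
  adj_b : K.G.Adj b q
  adj_y : K.G.Adj q y
  adj_z : K.G.Adj z q
  isPath_P : P.IsPath
  isPath_N : N.IsPath
  q_notMem_P : q ∉ P.support
  q_notMem_N : q ∉ N.support
  disjoint : ∀ x ∈ P.support, x ∉ N.support
  (i j k : ℕ)
  i_pos : 0 < i
  i_lt : i < j
  j_lt : j < k
  k_lt : k < degree F q
  fan_i : K.fan q a i = y
  fan_j : K.fan q a j = b
  fan_k : K.fan q a k = z
  fan_notMem : ∀ m, 0 < m → m < j → m ≠ i → K.fan q a m ∉ P.support ∧ K.fan q a m ∉ N.support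
  dual : ∀ X : Finset V → ℤˣ,
    (∀ x y, K.G.Adj x y → K.cob X x y ≠ 1 → s(x, y) ∈ arc q P ∪ arc q N) →
    ∀ f ∈ F, ∀ g ∈ F, X f = X g

theorem exists_crossing (hF : FacesConnected F) (hχ : eulerChar F = 0) : Nonempty K.Crossing := by
  obtain ⟨C⟩ := exists_essentialCycle (K := K) hF hχ
  have ha := C.adj_a
  have hd := degree_pos ha
  obtain ⟨j, hj, hbj⟩ := exists_fan ha C.adj_b.symm
  have hj0 : j ≠ 0 := by
    rintro rfl
    exact C.ne hbj
  have hj1 : j ≠ 1 := by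
    rintro rfl
    refine EssentialCycle.nx_notMem (C := C) ?_
    have : K.nx C.q C.a = C.b := hbj
    rw [this]
    exact .inr C.P.end_mem_support
  obtain ⟨w, hw⟩ := EssentialCycle.nx_mem_leftSide (C := C)
  obtain ⟨y, ⟨i, ⟨hi0, hij⟩, rfl⟩, N, hN, hNw, hNS⟩ :=
    exists_path_from_last (Set.image (K.fan C.q C.a) (Set.Ioo 0 j)) w
      ⟨_, w.start_mem_support, 1, ⟨one_pos, by omega⟩, rfl⟩
  have hNQ : ∀ x ∈ N.support, x ∉ C.verts := fun x hx => hw x (hNw x hx)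
  have hz : K.fan C.q C.a (degree F C.q - 1) = K.nx C.a C.q := (nx_fan_zero ha).symm
  have hjk : j < degree F C.q - 1 := by
    refine lt_of_le_of_ne (by omega) fun h => hNQ _ N.end_mem_support ?_
    rw [← hz, ← h, hbj]
    exact .inr C.P.end_mem_support
  have hqN : C.q ∉ N.support := fun h => hNQ _ h (.inl rfl)
  have hdisj : ∀ x ∈ C.P.support, x ∉ N.support := fun x hx h => hNQ _ h (.inr hx)
  have hyz : K.fan C.q C.a i ≠ K.nx C.a C.q := fun h => by
    have := fan_injOn ha (by omega) (by omega) (h.trans hz.symm)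
    omega
  have hadjz : K.G.Adj (K.nx C.a C.q) C.q := (K.adj_nx ha.symm).symm
  refine ⟨⟨C.q, C.a, C.b, _, _, C.P, N, ha, C.adj_b, fan_adj ha i, hadjz, C.isPath, hN,
    C.q_notMem, hqN, hdisj, i, j, degree F C.q - 1, hi0, hij, hjk, by omega, rfl, hbj, hz,
    fun m hm hmj hmi => ⟨fun h => ?_, fun h => ?_⟩, fun X hX => ?_⟩⟩
  · rcases EssentialCycle.eq_or_of_adj (.inr h) (fan_adj ha m) with h | h
    · exact fan_ne ha hm (by omega) h
    · exact hmj.ne (fan_injOn ha (by omega) hj (h.trans hbj.symm))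
  · exact hmi (fan_injOn ha (by omega) (by omega) (hNS _ h ⟨m, ⟨hm, hmj⟩, rfl⟩))
  · have hP : ∀ v ∈ C.P.support, ∀ t, K.G.Adj v t → K.cob X v t ≠ 1 → s(v, t) ∈ arc C.q C.P :=
      fun v hv t hvt h => (hX v t hvt h).resolve_right
        (notMem_arc_of_notMem (fun h => C.q_notMem (h ▸ hv)) (hdisj v hv))
    have hN' : ∀ v ∈ N.support, ∀ t, K.G.Adj v t → K.cob X v t ≠ 1 → s(v, t) ∈ arc C.q N :=
      fun v hv t hvt h => (hX v t hvt h).resolve_left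
        (notMem_arc_of_notMem (fun h => hqN (h ▸ hv)) fun h => hdisj v h hv)
    have hPv : ∀ {x y}, s(x, y) ∈ arc C.q C.P → K.cob X x y = K.cob X C.q C.a := by
      intro x y h
      simpa [Int.units_inv_eq_self] using
        (isFlat_cob X).eq_or_of_mem_arc C.isPath ha C.adj_b C.q_notMem C.ne hP h
    have hNv : ∀ {x y}, s(x, y) ∈ arc C.q N → K.cob X x y = K.cob X C.q (K.fan C.q C.a i) := by
      intro x y h
      simpa [Int.units_inv_eq_self] using
        (isFlat_cob X).eq_or_of_mem_arc hN (fan_adj ha i) hadjz hqN hyz hN' h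
    have hleft : X (K.tri C.b C.q) = X (K.tri C.q C.a) := by
      refine (EssentialCycle.dart_induction (C := C)
        (ψ := fun u v => X (K.tri u v) = X (K.tri C.q C.a))
        (fun u v w _ hv _ huw huv hvw ht h => ?_) rfl).1
      rw [← h]
      refine tri_left_constant X huv hvw huw fun t hvt htu htw => ?_
      by_contra hne
      exact (ht t (mem_verts_of_mem_arc
        (Sym2.eq_swap ▸ hP v hv t hvt hne)) hvt).elim htu htw
    have hfan : ∀ m, 0 < m → m < j → m ≠ i → K.cob X C.q (K.fan C.q C.a m) = 1 := by
      intro m h0 hmj hmi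
      by_contra hne
      rcases hX _ _ (fan_adj ha m) hne with h | h
      · rcases eq_or_eq_of_mem_arc C.q_notMem h with h | h
        · exact fan_ne ha h0 (by omega) h
        · exact hmj.ne (fan_injOn ha (by omega) hj (h.trans hbj.symm))
      · rcases eq_or_eq_of_mem_arc hqN h with h | h
        · exact hmi (fan_injOn ha (by omega) (by omega) h)
        · have := fan_injOn ha (by omega) (by omega) (h.trans hz.symm)
          omega
    have hβ : K.cob X C.q (K.fan C.q C.a i) = 1 := by
      obtain ⟨i', rfl⟩ : ∃ m, i = m + 1 := ⟨i - 1, by omega⟩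
      have h1 := tri_fan_constant X ha (Nat.zero_le i') fun m h1 h2 =>
        hfan m h1 (by omega) (by omega)
      have h2 := cob_fan X ha i'
      have h3 := tri_fan_constant X ha (m := i' + 1) (n := j - 1) (by omega) fun m h1 h2 =>
        hfan m (by omega) (by omega) (by omega)
      rw [← tri_fan_eq ha (by omega), hbj, hleft, h2, h1, fan_zero] at h3
      exact (mul_eq_right.1 h3.symm)
    have hα : K.cob X C.q C.a = 1 := by
      refine eq_one_of_ne_neg_one fun hα => C.not_bd X fun x y hxy => ⟨fun h => ?_, fun h => ?_⟩
      · refine (hX x y hxy (by rw [h]; decide)).resolve_right fun h' => ?_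
        rw [hNv h', hβ] at h
        exact absurd h (by decide)
      · rw [hPv h, hα]
    refine dualConnected_edges (K := K) hF X fun x y hxy _ => ?_
    rw [← cob_eq_one_iff]
    by_contra hne
    rcases hX x y hxy hne with h | h
    · exact hne ((hPv h).trans hα)
    · exact hne ((hNv h).trans hβ)

end OrientedTriangulation

namespace OrientedTriangulation

variable {V : Type*} [DecidableEq V] {F : Finset (Finset V)} {K : OrientedTriangulation F}
variable {M : Type*} [Group M] {T : V → V → M} {a b q v x y : V}

theorem exists_face_of_mem_vertices (h : v ∈ vertices F) : ∃ f ∈ F, v ∈ f := by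
  simpa [vertices, Finset.mem_sup] using h

theorem reachable_of_mem_vertices (hF : FacesConnected F) (ha : a ∈ vertices F)
    (hb : b ∈ vertices F) : K.G.Reachable a b := by
  have hface : ∀ f ∈ F, ∀ x ∈ f, ∀ y ∈ f, K.G.Reachable x y := by
    intro f hf x hx y hy
    by_cases hxy : x = y
    · exact hxy ▸ .refl _
    · exact (adj_iff_exists.2 ⟨hxy, f, hf, hx, hy⟩).reachable
  obtain ⟨f, hf, haf⟩ := exists_face_of_mem_vertices ha
  obtain ⟨g, hg, hbg⟩ := exists_face_of_mem_vertices hb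
  have key : ∀ x ∈ g, K.G.Reachable a x := by
    have := hF f hf g hg
    clear hg hbg
    induction this with
    | refl => exact fun x hx => hface f hf a haf x hx
    | tail _ h ih =>
      intro x hx
      obtain ⟨c, hc⟩ := Finset.card_pos.1 (h.2.2 ▸ two_pos)
      rw [Finset.mem_inter] at hc
      exact (ih c hc.1).trans (hface _ h.2.1 c hc.2 x hx)
  exact key b hbg

theorem exists_parent (hF : FacesConnected F) (hq : q ∈ vertices F) :
    ∃ (l : V → ℕ) (p : V → V), ∀ v ∈ vertices F, v ≠ q → K.G.Adj v (p v) ∧ l (p v) < l v := by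
  have : ∀ v, ∃ p, v ∈ vertices F → v ≠ q → K.G.Adj v p ∧ K.G.dist p q < K.G.dist v q := by
    intro v
    by_cases hv : v ∈ vertices F ∧ v ≠ q
    · obtain ⟨w, hw⟩ := (reachable_of_mem_vertices (K := K) hF hv.1 hq).exists_walk_length_eq_dist
      cases w with
      | nil => exact absurd rfl hv.2
      | cons h w =>
        refine ⟨_, fun _ _ => ⟨h, ?_⟩⟩
        rw [← hw, Walk.length_cons]
        exact Nat.lt_succ_of_le (dist_le w)
    · exact ⟨v, fun h1 h2 => absurd ⟨h1, h2⟩ hv⟩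
  choose p hp using this
  exact ⟨fun v => K.G.dist v q, p, hp⟩

section Parent

variable {Z : Finset (Finset V)} {W : Finset V} {l : V → ℕ} {p : V → V}

variable (F) in
/-- The edges joining the vertices outside `W` to their parents. -/
def parentEdges (W : Finset V) (p : V → V) : Finset (Finset V) :=
  (vertices F \ W).image fun v => {v, p v}

theorem IsFlat.eq_one_of_parentEdges (hT : K.IsFlat T) (hZW : ∀ e ∈ Z, e ⊆ W)
    (hp : ∀ v ∈ vertices F \ W, K.G.Adj v (p v) ∧ l (p v) < l v)
    (h : ∀ x y, K.G.Adj x y → {x, y} ∉ Z ∪ parentEdges F W p → T x y = 1) :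
    ∀ x y, K.G.Adj x y → {x, y} ∉ Z → T x y = 1 := by
  classical
  have key : ∀ v ∈ vertices F \ W, T v (p v) = 1 := by
    by_contra! hcon
    obtain ⟨v, hv, hne⟩ := hcon
    obtain ⟨v, hv, hmax⟩ := Finset.exists_max_image
      ((vertices F \ W).filter fun v => T v (p v) ≠ 1) l ⟨v, by simp [hne, Finset.mem_sdiff.1 hv]⟩
    rw [Finset.mem_filter] at hv
    refine hv.2 (hT.eq_one_of_forall_ne (hp v hv.1).1 fun c hc hcp => ?_)
    by_contra hne
    have hmem : ({v, c} : Finset V) ∈ Z ∪ parentEdges F W p := by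
      by_contra hn
      exact hne (h v c hc hn)
    rcases Finset.mem_union.1 hmem with hmem | hmem
    · exact (Finset.mem_sdiff.1 hv.1).2 (hZW _ hmem (by simp))
    · obtain ⟨w, hw, heq⟩ := Finset.mem_image.1 hmem
      rw [pair_eq_pair_iff] at heq
      rcases Sym2.eq_iff.1 heq with ⟨rfl, h2⟩ | ⟨rfl, h2⟩
      · exact hcp h2.symm
      · have hlt := (hp w hw).2
        have := hmax w (Finset.mem_filter.2 ⟨hw, fun h1 => hne ?_⟩)
        · rw [h2] at hlt
          omega
        · rw [h2] at h1
          rw [hT.inv hc.symm, h1, inv_one]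
  intro x y hxy hZ
  by_cases hmem : ({x, y} : Finset V) ∈ parentEdges F W p
  · obtain ⟨w, hw, heq⟩ := Finset.mem_image.1 hmem
    rw [pair_eq_pair_iff] at heq
    rcases Sym2.eq_iff.1 heq with ⟨rfl, rfl⟩ | ⟨rfl, rfl⟩
    · exact key w hw
    · rw [hT.inv hxy.symm, key w hw, inv_one]
  · exact h x y hxy (by simp [hZ, hmem])

theorem card_parentEdges (hp : ∀ v ∈ vertices F \ W, K.G.Adj v (p v) ∧ l (p v) < l v) :
    (parentEdges F W p).card = (vertices F \ W).card := by
  refine Finset.card_image_of_injOn fun v hv w hw heq => ?_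
  change ({v, p v} : Finset V) = {w, p w} at heq
  rw [pair_eq_pair_iff] at heq
  rcases Sym2.eq_iff.1 heq with ⟨h, -⟩ | ⟨h1, h2⟩
  · exact h
  · have := (hp v hv).2
    have := (hp w hw).2
    rw [← h1] at this
    rw [h2] at *
    omega

variable (K T) in
open Classical in
/-- The edges outside `S` with a nontrivial transport. -/
noncomputable def badEdges (S : Finset (Finset V)) : Finset (Finset V) :=
  (edges F \ S).filter fun e => ∃ x y, e = {x, y} ∧ K.G.Adj x y ∧ T x y ≠ 1

theorem badEdges_subset (S : Finset (Finset V)) : K.badEdges T S ⊆ edges F \ S := by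
  classical
  exact Finset.filter_subset _ _

theorem pair_mem_badEdges (hT : K.IsFlat T) {S : Finset (Finset V)} (h : K.G.Adj x y) :
    {x, y} ∈ K.badEdges T S ↔ {x, y} ∉ S ∧ T x y ≠ 1 := by
  classical
  rw [badEdges, Finset.mem_filter, Finset.mem_sdiff]
  refine ⟨fun ⟨⟨_, h1⟩, u, v, heq, huv, hne⟩ => ⟨h1, fun h2 => hne ?_⟩,
    fun ⟨h1, h2⟩ => ⟨⟨pair_mem_edges h, h1⟩, x, y, rfl, h, h2⟩⟩
  rw [pair_eq_pair_iff] at heq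
  rcases Sym2.eq_iff.1 heq with ⟨rfl, rfl⟩ | ⟨rfl, rfl⟩
  · exact h2
  · rw [hT.inv h, h2, inv_one]

/-- If the nontrivial transports outside `S` can be separated, one of them can be removed. -/
theorem exists_gauge_badEdges_ssubset (hT : K.IsFlat T) {S : Finset (Finset V)}
    (X : Finset V → ℤˣ) (hX : ∀ u v, K.G.Adj u v → {u, v} ∉ S → T u v = 1 → K.cob X u v = 1)
    (hxy : K.G.Adj x y) (hS : {x, y} ∉ S) (hne : K.cob X x y ≠ 1) :
    ∃ g, K.badEdges (K.gauge g T) S ⊂ K.badEdges T S := by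
  classical
  refine ⟨fun f => if X f = X (K.tri x y) then (T x y)⁻¹ else 1, ?_⟩
  have hflat := hT.gauge fun f => if X f = X (K.tri x y) then (T x y)⁻¹ else 1
  rw [Finset.ssubset_iff_of_subset]
  · refine ⟨{x, y}, (pair_mem_badEdges hT hxy).2 ⟨hS, fun h => hne (hX x y hxy hS h)⟩, fun h => ?_⟩
    refine ((pair_mem_badEdges hflat hxy).1 h).2 ?_
    rw [Ne, cob_eq_one_iff, eq_comm] at hne
    simp [gauge, hne]
  · intro e he
    obtain ⟨u, v, huv, rfl⟩ := exists_of_mem_edges (K := K)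
      (Finset.mem_sdiff.1 (badEdges_subset S he)).1
    rw [pair_mem_badEdges hflat huv] at he
    refine (pair_mem_badEdges hT huv).2 ⟨he.1, fun h => he.2 ?_⟩
    have := hX u v huv he.1 h
    rw [cob_eq_one_iff] at this
    simp [gauge, h, this]

/-- The frames can be chosen so that the transport is trivial away from `Z`, provided that `Z`
does not disconnect the surface and has enough edges. -/
theorem IsFlat.exists_gauge (hF : FacesConnected F) (hχ : eulerChar F = 0) (hT : K.IsFlat T)
    (hZ : Z ⊆ edges F) (hZW : ∀ e ∈ Z, e ⊆ W) (hW : W ⊆ vertices F) (hq : q ∈ W)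
    (hcard : W.card + 1 ≤ Z.card)
    (hdual : ∀ X : Finset V → ℤˣ, (∀ x y, K.G.Adj x y → {x, y} ∉ Z → K.cob X x y = 1) →
      ∀ f ∈ F, ∀ g ∈ F, X f = X g) :
    ∃ g, ∀ x y, K.G.Adj x y → {x, y} ∉ Z → K.gauge g T x y = 1 := by
  obtain ⟨l, p, hp⟩ := exists_parent (K := K) hF (hW hq)
  replace hp : ∀ v ∈ vertices F \ W, K.G.Adj v (p v) ∧ l (p v) < l v := fun v hv => by
    rw [Finset.mem_sdiff] at hv
    exact hp v hv.1 fun h => hv.2 (h ▸ hq)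
  set S := Z ∪ parentEdges F W p with hS
  have hSF : S ⊆ edges F := by
    refine Finset.union_subset hZ fun e he => ?_
    obtain ⟨v, hv, rfl⟩ := Finset.mem_image.1 he
    exact pair_mem_edges (hp v hv).1
  have hSc : (vertices F).card + 1 ≤ S.card := by
    rw [hS, Finset.card_union_of_disjoint, card_parentEdges hp]
    · have := Finset.card_sdiff_add_card_eq_card hW
      omega
    · rw [Finset.disjoint_left]
      intro e he he'
      obtain ⟨v, hv, rfl⟩ := Finset.mem_image.1 he'
      exact (Finset.mem_sdiff.1 hv).2 (hZW _ he (by simp))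
  obtain ⟨g, hg⟩ : ∃ g, ∀ g', ¬ (K.badEdges (K.gauge g' T) S).card <
      (K.badEdges (K.gauge g T) S).card := by
    exact ⟨_, Function.not_lt_argmin fun g => (K.badEdges (K.gauge g T) S).card⟩
  have hgT := hT.gauge g
  refine ⟨g, hgT.eq_one_of_parentEdges hZW hp fun x y hxy hxyS => ?_⟩
  by_contra hne
  have hbad : {x, y} ∈ K.badEdges (K.gauge g T) S := (pair_mem_badEdges hgT hxy).2 ⟨hxyS, hne⟩
  have hR : ¬ K.DualConnected ((edges F \ S) \ K.badEdges (K.gauge g T) S) := by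
    intro h
    have h1 := h.card_le (Finset.sdiff_subset.trans Finset.sdiff_subset)
    have h2 := Finset.card_sdiff_add_card_eq_card (badEdges_subset (K := K) (T := K.gauge g T) S)
    have h3 := Finset.card_sdiff_add_card_eq_card hSF
    have h4 := Finset.card_pos.2 ⟨_, hbad⟩
    rw [eulerChar] at hχ
    omega
  rw [DualConnected] at hR
  push Not at hR
  obtain ⟨X, hX, f, hf, f', hf', hff⟩ := hR
  obtain ⟨u, v, huv, huvS, hcob⟩ : ∃ u v, K.G.Adj u v ∧ {u, v} ∉ S ∧ K.cob X u v ≠ 1 := by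
    by_contra! hcon
    exact hff (hdual X ((isFlat_cob X).eq_one_of_parentEdges hZW hp hcon) f hf f' hf')
  obtain ⟨g', hg'⟩ := exists_gauge_badEdges_ssubset hgT X (S := S) (fun u v huv hS h1 => by
    rw [cob_eq_one_iff]
    refine hX u v huv ?_
    rw [Finset.mem_sdiff, Finset.mem_sdiff, pair_mem_badEdges hgT huv]
    exact ⟨⟨pair_mem_edges huv, hS⟩, fun h => h.2 h1⟩) huv huvS hcob
  rw [gauge_gauge] at hg'
  exact hg _ (Finset.card_lt_card hg')

end Parent

end OrientedTriangulation

namespace OrientedTriangulation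

variable {V : Type*} [DecidableEq V] {F : Finset (Finset V)} {K : OrientedTriangulation F}

theorem eq_or_mul_eq_one_of_commute : ∀ {s t : Equiv.Perm (Fin 3)},
    t⁻¹ * (s⁻¹ * (t * s)) = 1 → s = 1 ∨ t = 1 ∨ s = t ∨ t * s = 1 := by
  decide

theorem isCycle_cons_concat {a b q : V} {P : K.G.Walk a b} (hP : P.IsPath) (ha : K.G.Adj q a)
    (hb : K.G.Adj b q) (hq : q ∉ P.support) (hab : a ≠ b) :
    (Walk.cons ha (P.concat hb)).IsCycle := by
  rw [Walk.cons_isCycle_iff, Walk.concat_isPath_iff, Walk.edges_concat, List.concat_eq_append,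
    List.mem_append, List.mem_singleton]
  refine ⟨⟨hP, hq⟩, ?_⟩
  rintro (h | h)
  · exact hq (P.fst_mem_support_of_mem_edges h)
  · rw [Sym2.eq_swap] at h
    exact hab (Sym2.congr_left.1 h)

theorem mem_edges_cons_concat {a b q : V} {P : K.G.Walk a b} {ha : K.G.Adj q a}
    {hb : K.G.Adj b q} {e : Sym2 V} :
    e ∈ (Walk.cons ha (P.concat hb)).edges ↔ e ∈ arc q P := by
  simp only [Walk.edges_cons, Walk.edges_concat, List.concat_eq_append, List.mem_cons,
    List.mem_append, List.not_mem_nil, or_false, arc, Set.mem_ofPred_eq]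
  tauto

theorem adj_of_mem_arc {a b q x y : V} {P : K.G.Walk a b} (ha : K.G.Adj q a) (hb : K.G.Adj b q)
    (h : s(x, y) ∈ arc q P) : K.G.Adj x y :=
  Walk.adj_of_mem_edges _ ((mem_edges_cons_concat (ha := ha) (hb := hb)).2 h)

theorem mem_vertices_of_mem_support {a b x q : V} {P : K.G.Walk a b} (ha : K.G.Adj a q)
    (hx : x ∈ P.support) : x ∈ vertices F := by
  induction P generalizing q with
  | nil =>
    rw [Walk.support_nil, List.mem_singleton] at hx
    exact hx ▸ mem_vertices_of_adj ha
  | cons h P ih =>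
    rw [Walk.support_cons, List.mem_cons] at hx
    rcases hx with rfl | hx
    · exact mem_vertices_of_adj h
    · exact ih h.symm hx

theorem gauge_one {M : Type*} [Group M] (T : V → V → M) : K.gauge 1 T = T := by
  ext a b
  simp [gauge]

namespace Crossing

variable (C : K.Crossing)

/-- The edges of the two arcs. -/
def edgeList : List (Sym2 V) :=
  s(C.q, C.a) :: s(C.b, C.q) :: s(C.q, C.y) :: s(C.z, C.q) :: (C.P.edges ++ C.N.edges)

variable {C}

theorem mem_edgeList {e : Sym2 V} : e ∈ C.edgeList ↔ e ∈ arc C.q C.P ∪ arc C.q C.N := by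
  simp only [edgeList, arc, List.mem_cons, List.mem_append, Set.mem_union, Set.mem_ofPred_eq]
  tauto

theorem a_ne_b : C.a ≠ C.b := by
  rw [← C.fan_j]
  exact (fan_ne C.adj_a (C.i_pos.trans C.i_lt) (C.j_lt.trans C.k_lt)).symm

theorem y_ne_z : C.y ≠ C.z := by
  rw [← C.fan_i, ← C.fan_k]
  intro h
  have := C.i_lt
  have := C.j_lt
  have := C.k_lt
  have := fan_injOn C.adj_a (by omega) (by omega) h
  omega

theorem nodup_edgeList : C.edgeList.Nodup := by
  have hP : ∀ x, s(C.q, x) ∉ C.P.edges := fun x h =>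
    C.q_notMem_P (C.P.fst_mem_support_of_mem_edges h)
  have hN : ∀ x, s(C.q, x) ∉ C.N.edges := fun x h =>
    C.q_notMem_N (C.N.fst_mem_support_of_mem_edges h)
  have h1 : ∀ x ∈ C.P.support, ∀ y ∈ C.N.support, x ≠ y := fun x hx y hy h =>
    C.disjoint x hx (h ▸ hy)
  have hq : ∀ x y, s(C.q, x) = s(C.q, y) ↔ x = y := fun x y => Sym2.congr_right
  have hay := h1 _ C.P.start_mem_support _ C.N.start_mem_support
  have haz := h1 _ C.P.start_mem_support _ C.N.end_mem_support
  have hby := h1 _ C.P.end_mem_support _ C.N.start_mem_support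
  have hbz := h1 _ C.P.end_mem_support _ C.N.end_mem_support
  rw [edgeList, Sym2.eq_swap (a := C.b), Sym2.eq_swap (a := C.z)]
  simp only [List.nodup_cons, List.mem_cons, List.mem_append, hP, hN, hq, a_ne_b, y_ne_z, hay, haz,
    hby, hbz, or_self, not_false_eq_true, true_and]
  refine List.nodup_append.2
    ⟨C.isPath_P.isTrail.edges_nodup, C.isPath_N.isTrail.edges_nodup, fun e he e' he' h => ?_⟩
  subst h
  induction e with | _ x y =>
  exact C.disjoint x (C.P.fst_mem_support_of_mem_edges he) (C.N.fst_mem_support_of_mem_edges he')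

theorem exists_gauge (hF : FacesConnected F) (hχ : eulerChar F = 0) {M : Type*} [Group M]
    {T : V → V → M} (hT : K.IsFlat T) :
    ∃ g, ∀ x y, K.G.Adj x y → K.gauge g T x y ≠ 1 → s(x, y) ∈ arc C.q C.P ∪ arc C.q C.N := by
  let Z : Finset (Finset V) := C.edgeList.toFinset.image Sym2.toFinset
  have hZ : ∀ {x y}, {x, y} ∈ Z ↔ s(x, y) ∈ arc C.q C.P ∪ arc C.q C.N := by
    intro x y
    rw [← mem_edgeList, ← Sym2.toFinset_mk_eq, ← List.mem_toFinset]
    exact sym2_toFinset_injective.mem_finset_image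
  let W : Finset V := (C.q :: (C.P.support ++ C.N.support)).toFinset
  have hW : ∀ {x}, x ∈ W ↔ x = C.q ∨ x ∈ C.P.support ∨ x ∈ C.N.support := by simp [W]
  have hP : ∀ {x y}, s(x, y) ∈ arc C.q C.P → x ∈ W := fun h =>
    hW.2 ((mem_verts_of_mem_arc h).imp_right Or.inl)
  have hN : ∀ {x y}, s(x, y) ∈ arc C.q C.N → x ∈ W := fun h =>
    hW.2 ((mem_verts_of_mem_arc h).imp_right Or.inr)
  have hmemZ : ∀ e ∈ Z, ∃ x y, e = {x, y} ∧ K.G.Adj x y ∧ x ∈ W ∧ y ∈ W := by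
    intro e he
    obtain ⟨e', he', rfl⟩ := Finset.mem_image.1 he
    rw [List.mem_toFinset, mem_edgeList] at he'
    induction e' with | _ x y =>
    refine ⟨x, y, Sym2.toFinset_mk_eq, ?_⟩
    rcases he' with he | he
    · exact ⟨adj_of_mem_arc C.adj_a C.adj_b he, hP he, hP (Sym2.eq_swap ▸ he)⟩
    · exact ⟨adj_of_mem_arc C.adj_y C.adj_z he, hN he, hN (Sym2.eq_swap ▸ he)⟩
  refine (hT.exists_gauge (Z := Z) (W := W) (q := C.q) hF hχ ?_ ?_ ?_ ?_ ?_ ?_).imp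
    fun g hg x y hxy hne => hZ.1 (by_contra fun h => hne (hg x y hxy h))
  · intro e he
    obtain ⟨x, y, rfl, hxy, -⟩ := hmemZ e he
    exact pair_mem_edges hxy
  · intro e he
    obtain ⟨x, y, rfl, -, hx, hy⟩ := hmemZ e he
    simp [Finset.insert_subset_iff, hx, hy]
  · intro x hx
    rcases hW.1 hx with rfl | hx | hx
    · exact mem_vertices_of_adj C.adj_a
    · exact mem_vertices_of_mem_support C.adj_a.symm hx
    · exact mem_vertices_of_mem_support C.adj_y.symm hx
  · exact hW.2 (Or.inl rfl)
  · rw [Finset.card_image_of_injective _ sym2_toFinset_injective,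
      List.toFinset_card_of_nodup nodup_edgeList]
    refine (Nat.add_le_add_right (List.toFinset_card_le _) 1).trans ?_
    simp only [edgeList, List.length_cons, List.length_append, Walk.length_support,
      Walk.length_edges]
    omega
  · exact fun X hX => C.dual X fun x y hxy hne => hZ.1 (by_contra fun h => hne (hX x y hxy h))

variable {M : Type*} [Group M] {T : V → V → M}

theorem exists_isCycle_of_commute (hT : K.IsFlat T)
    (h : ∀ x y, K.G.Adj x y → T x y ≠ 1 → s(x, y) ∈ arc C.q C.P ∪ arc C.q C.N)
    (hM : ∀ {s t : M}, t⁻¹ * (s⁻¹ * (t * s)) = 1 → s = 1 ∨ t = 1 ∨ s = t ∨ t * s = 1) :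
    ∃ (g : Finset V → M) (q : V) (E : K.G.Walk q q), E.IsCycle ∧
      ∀ x y, K.G.Adj x y → s(x, y) ∉ E.edges → K.gauge g T x y = 1 := by
  have hi := C.i_pos
  have hij := C.i_lt
  have hjk := C.j_lt
  have hk := C.k_lt
  have hP : ∀ v ∈ C.P.support, ∀ t, K.G.Adj v t → T v t ≠ 1 → s(v, t) ∈ arc C.q C.P :=
    fun v hv t hvt hne => (h v t hvt hne).resolve_right
      (notMem_arc_of_notMem (fun h => C.q_notMem_P (h ▸ hv)) (C.disjoint v hv))
  have hN : ∀ v ∈ C.N.support, ∀ t, K.G.Adj v t → T v t ≠ 1 → s(v, t) ∈ arc C.q C.N :=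
    fun v hv t hvt hne => (h v t hvt hne).resolve_left
      (notMem_arc_of_notMem (fun h => C.q_notMem_N (h ▸ hv)) fun h => C.disjoint v h hv)
  have hb : T C.q C.b = (T C.q C.a)⁻¹ := by
    rw [hT.inv C.adj_b,
      (hT.dart_constant C.isPath_P C.adj_a C.adj_b C.q_notMem_P a_ne_b hP).1]
  have hz : T C.q C.z = (T C.q C.y)⁻¹ := by
    rw [hT.inv C.adj_z,
      (hT.dart_constant C.isPath_N C.adj_y C.adj_z C.q_notMem_N y_ne_z hN).1]
  have h4 := hT.mul_four_eq_one C.adj_a hi hij hjk hk fun m hm h0 h1 h2 h3 => by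
    have hinj : ∀ {n}, n < degree F C.q → K.fan C.q C.a m = K.fan C.q C.a n → m = n :=
      fun hn => fan_injOn C.adj_a hm hn
    by_contra hne
    rcases h _ _ (fan_adj C.adj_a m) hne with h | h
    · rcases eq_or_eq_of_mem_arc C.q_notMem_P h with h | h
      · exact h0 (hinj (by omega) h)
      · exact h2 (hinj (by omega) (h.trans C.fan_j.symm))
    · rcases eq_or_eq_of_mem_arc C.q_notMem_N h with h | h
      · exact h1 (hinj (by omega) (h.trans C.fan_i.symm))
      · exact h3 (hinj hk (h.trans C.fan_k.symm))
  rw [C.fan_i, C.fan_j, C.fan_k, hb, hz] at h4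
  rcases hM h4 with hα | hβ | hαβ | hαβ
  · refine ⟨1, C.q, _, isCycle_cons_concat C.isPath_N C.adj_y C.adj_z C.q_notMem_N y_ne_z,
      fun x y hxy hE => ?_⟩
    rw [gauge_one]
    rw [mem_edges_cons_concat] at hE
    by_contra hne
    have hx := (h x y hxy hne).resolve_right hE
    rcases hT.eq_or_of_mem_arc C.isPath_P C.adj_a C.adj_b C.q_notMem_P a_ne_b hP hx with h | h <;>
    simp [h, hα] at hne
  · refine ⟨1, C.q, _, isCycle_cons_concat C.isPath_P C.adj_a C.adj_b C.q_notMem_P a_ne_b,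
      fun x y hxy hE => ?_⟩
    rw [gauge_one]
    rw [mem_edges_cons_concat] at hE
    by_contra hne
    have hx := (h x y hxy hne).resolve_left hE
    rcases hT.eq_or_of_mem_arc C.isPath_N C.adj_y C.adj_z C.q_notMem_N y_ne_z hN hx with h | h <;>
    simp [h, hβ] at hne
  · have hfan : ∀ n, K.fan C.q C.y n = K.fan C.q C.a (C.i + n) := fun n => by
      rw [← fan_fan, C.fan_i]
    obtain ⟨g, E, hE⟩ := exists_isCycle_of_corner hT C.adj_y (i := C.j - C.i) (by omega) (by omega)
      (by rw [hfan, Nat.add_sub_cancel' hij.le, C.fan_j]) C.isPath_N C.adj_z C.isPath_P.reverse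
      C.adj_a.symm C.q_notMem_N (by simpa using C.q_notMem_P)
      (fun x hx hx' => C.disjoint x (by simpa using hx') hx)
      (fun n h0 hn => by
        rw [hfan, Walk.support_reverse, List.mem_reverse]
        exact (C.fan_notMem _ (by omega) (by omega) (by omega)).symm)
      (fun x y hxy hne => by
        have := h x y hxy hne
        rw [arc, arc, Sym2.eq_swap (a := C.b), Sym2.eq_swap (a := C.z)] at this
        rw [Walk.edges_reverse, List.mem_reverse]
        rcases this with (h | h | h) | (h | h | h) <;> tauto)
      (by rw [hb, hαβ, inv_mul_cancel])
    exact ⟨g, C.q, E, hE⟩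
  · obtain ⟨g, E, hE⟩ := exists_isCycle_of_corner hT C.adj_a hi (by omega) C.fan_i C.isPath_P
      C.adj_b C.isPath_N C.adj_z C.q_notMem_P C.q_notMem_N C.disjoint
      (fun n h0 hn => C.fan_notMem n h0 (by omega) (by omega))
      (fun x y hxy hne => by
        have := h x y hxy hne
        rw [arc, arc, Sym2.eq_swap (a := C.b), Sym2.eq_swap (a := C.z)] at this
        rcases this with (h | h | h) | (h | h | h) <;> tauto) hαβ
    exact ⟨g, C.q, E, hE⟩

end Crossing

end OrientedTriangulation

open OrientedTriangulation in
theorem IsTorus.colorableAfterCut {V : Type*} [DecidableEq V] {F : Finset (Finset V)}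
    (hT : IsTorus F) (heven : ∀ v ∈ vertices F, Even (degree F v)) : ColorableAfterCut F := by
  obtain ⟨hF, hconn, ho, hχ⟩ := hT
  obtain ⟨K⟩ := exists_orientedTriangulation hF ho
  obtain ⟨C⟩ := exists_crossing (K := K) hconn hχ
  obtain ⟨col, hcol⟩ := exists_faceColoring hF.2.1
  obtain ⟨T, hT, hTcol⟩ := exists_isFlat_of_faceColoring (K := K) heven hcol
  obtain ⟨g, hg⟩ := C.exists_gauge hconn hχ hT
  obtain ⟨g', q, E, hE, hg'⟩ :=
    C.exists_isCycle_of_commute (hT.gauge g) hg eq_or_mul_eq_one_of_commute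
  refine colorableAfterCut_of_isCycle hcol hTcol (g' * g) hE ?_
  rwa [gauge_gauge] at hg'

end Fisk

open Fisk in
/-- Every even triangulation of the torus is either properly vertex
3-colorable, or becomes properly vertex 3-colorable after cutting along a
suitable simple closed curve.  The cut surface is encoded by a nonempty
connected set `C` of edges meeting every vertex in 0 or 2 edges (a simple
closed curve of edges), together with a coloring of the vertices of each face
that is proper on every face and consistent across every edge not in `C`. -/
theorem even_torus_colorable_after_cut {V : Type*} [DecidableEq V]
    (F : Finset (Finset V)) (hT : IsTorus F)
    (heven : ∀ v ∈ vertices F, Even (degree F v)) :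
    (∃ c : V → Fin 3, ProperColoring F c) ∨
    ∃ C : Finset (Finset V), C ⊆ edges F ∧ C.Nonempty ∧
      (∀ v : V, (C.filter (fun e => v ∈ e)).card = 0 ∨
                (C.filter (fun e => v ∈ e)).card = 2) ∧
      (∀ e ∈ C, ∀ e' ∈ C,
        Relation.ReflTransGen
          (fun x y => x ∈ C ∧ y ∈ C ∧ (x ∩ y).Nonempty) e e') ∧
      ∃ col : Finset V → V → Fin 3,
        (∀ f ∈ F, ∀ u ∈ f, ∀ w ∈ f, u ≠ w → col f u ≠ col f w) ∧
        (∀ f ∈ F, ∀ g ∈ F, f ≠ g → (f ∩ g).card = 2 → f ∩ g ∉ C →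
          ∀ u ∈ f ∩ g, col f u = col g u) :=
  Or.inr (IsTorus.colorableAfterCut hT heven)
end

section
/- The 7-vertex Möbius–Kantor triangulation of the torus (the unique 7-vertex triangulation, in which every vertex has degree 6) is not properly vertex-3-colorable, and it admits a properly 3-colorable triple cover on 21 vertices. -/
open Fisk

/-- The 7-vertex (Möbius–Kantor) triangulation of the torus, with vertex set
`ZMod 7` and faces `{i, i+1, i+3}` and `{i, i+2, i+3}`. -/
def T7 : Finset (Finset (ZMod 7)) :=
  Finset.univ.biUnion
    (fun i : ZMod 7 => {({i, i + 1, i + 3} : Finset (ZMod 7)),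
                        ({i, i + 2, i + 3} : Finset (ZMod 7))})

theorem Relation.ReflTransGen.of_chain {α : Type*} {r : α → α → Prop} (hr : ∀ x y, r x y → r y x)
    {s : ℕ → α} {n : ℕ} (hs : ∀ k < n, r (s k) (s (k + 1))) {k l : ℕ} (hk : k ≤ n) (hl : l ≤ n) :
    Relation.ReflTransGen r (s k) (s l) := by
  have from_zero : ∀ m ≤ n, Relation.ReflTransGen r (s 0) (s m) := by
    intro m hm
    induction m with
    | zero => exact .refl
    | succ m ih => exact (ih (by omega)).tail (hs m hm)
  have : Std.Symm r := ⟨hr⟩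
  exact (symm (from_zero k hk)).trans (from_zero l hl)

namespace Fisk

variable {V : Type*} [DecidableEq V]

theorem facesConnected_of_chain {F : Finset (Finset V)} (s : ℕ → Finset V) (n : ℕ)
    (hs : ∀ k < n, s k ∈ F ∧ s (k + 1) ∈ F ∧ (s k ∩ s (k + 1)).card = 2)
    (hF : ∀ f ∈ F, ∃ k < n + 1, f = s k) : FacesConnected F := by
  intro f hf g hg
  obtain ⟨k, hk, rfl⟩ := hF f hf
  obtain ⟨l, hl, rfl⟩ := hF g hg
  refine Relation.ReflTransGen.of_chain (fun x y h => ?_) hs (by omega) (by omega)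
  exact ⟨h.2.1, h.1, Finset.inter_comm x y ▸ h.2.2⟩

theorem linkConnected_of_chain {F : Finset (Finset V)} (s : V → ℕ → Finset V) (n : ℕ)
    (hs : ∀ v, ∀ k < n, s v k ∈ F ∧ s v (k + 1) ∈ F ∧ v ∈ s v k ∧ v ∈ s v (k + 1) ∧
      (s v k ∩ s v (k + 1)).card = 2)
    (hF : ∀ v, ∀ f ∈ F, v ∈ f → ∃ k < n + 1, f = s v k) : LinkConnected F := by
  intro v f hf g hg hvf hvg
  obtain ⟨k, hk, rfl⟩ := hF v f hf hvf
  obtain ⟨l, hl, rfl⟩ := hF v g hg hvg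
  refine Relation.ReflTransGen.of_chain (fun x y h => ?_) (hs v) (by omega) (by omega)
  exact ⟨h.2.1, h.1, h.2.2.2.1, h.2.2.1, Finset.inter_comm x y ▸ h.2.2.2.2⟩

theorem orientable_of_triples [Nonempty V] {F : Finset (Finset V)} (O : Finset (V × V × V))
    (hF : ∀ f ∈ F, ∃ t ∈ O, ({t.1, t.2.1, t.2.2} : Finset V) = f)
    (hO : ∀ s ∈ O, ∀ t ∈ O, s ≠ t → ∀ p ∈ orientedEdges s, p ∉ orientedEdges t) :
    Orientable F := by
  choose! o ho hof using hF
  refine ⟨o, hof, fun f hf g hg hfg => hO _ (ho f hf) _ (ho g hg) fun h => hfg ?_⟩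
  rw [← hof f hf, ← hof g hg, h]

theorem mem_edges {F : Finset (Finset V)} {e : Finset V} :
    e ∈ edges F ↔ ∃ f ∈ F, ∃ a ∈ f, ∃ b ∈ f, a ≠ b ∧ e = {a, b} := by
  simp only [edges, Finset.mem_biUnion, Finset.mem_powersetCard, Finset.card_eq_two]
  constructor
  · rintro ⟨f, hf, he, a, b, hab, rfl⟩
    exact ⟨f, hf, a, he (by simp), b, he (by simp), hab, rfl⟩
  · rintro ⟨f, hf, a, ha, b, hb, hab, rfl⟩
    exact ⟨f, hf, by simp [Finset.insert_subset_iff, ha, hb], a, b, hab, rfl⟩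

theorem forall_mem_edges {F : Finset (Finset V)} {P : Finset V → Prop} :
    (∀ e ∈ edges F, P e) ↔ ∀ f ∈ F, ∀ a ∈ f, ∀ b ∈ f, a ≠ b → P {a, b} := by
  simp only [mem_edges]
  grind

theorem properColoring_of_forall_mem {C : Type*} {F : Finset (Finset V)} {c : V → C}
    (h : ∀ f ∈ F, ∀ u ∈ f, ∀ w ∈ f, u ≠ w → c u ≠ c w) : ProperColoring F c := by
  refine forall_mem_edges.mpr fun f hf a ha b hb hab u hu w hw => h f hf u ?_ w ?_ <;> grind

/-- The six faces around `v` of the triangular lattice spanned by `a` and `b`, in cyclic order. -/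
def hexagonFace {A : Type*} [DecidableEq A] [AddCommGroup A] (a b v : A) (k : ℕ) : Finset A :=
  match k with
  | 0 => {v, v + a, v + (a + b)}
  | 1 => {v, v + (a + b), v + b}
  | 2 => {v, v + b, v - a}
  | 3 => {v, v - a, v - (a + b)}
  | 4 => {v, v - (a + b), v - b}
  | _ => {v, v - b, v + a}

end Fisk

/-- The faces with counterclockwise vertices `i`, `i + a`, `i + a + b`, where `a = 1` and
`b = 16`. -/
def upFace : Fin 21 ↪ Finset (Fin 21) :=
  ⟨fun i => {i, i + 1, i + 17}, by unfold Function.Injective; decide +kernel⟩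

/-- The faces with counterclockwise vertices `i`, `i + a + b`, `i + b`, where `a = 1` and
`b = 16`. -/
def downFace : Fin 21 ↪ Finset (Fin 21) :=
  ⟨fun i => {i, i + 16, i + 17}, by unfold Function.Injective; decide +kernel⟩

theorem upFace_ne_downFace : ∀ i j, upFace i ≠ downFace j := by decide +kernel

/-- The quotient of the triangular lattice by a sublattice of index 21, with the two lattice
generators mapping to `1` and `16`. -/
def T21 : Finset (Finset (Fin 21)) :=
  (Finset.univ.map upFace).disjUnion (Finset.univ.map downFace)
    (by simpa [Finset.disjoint_left] using fun i j => (upFace_ne_downFace i j).symm)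

theorem forall_mem_T21 {P : Finset (Fin 21) → Prop} :
    (∀ f ∈ T21, P f) ↔ ∀ i : Fin 21, P {i, i + 1, i + 17} ∧ P {i, i + 16, i + 17} := by
  simp only [T21, Finset.mem_disjUnion, Finset.mem_map, Finset.mem_univ, true_and, upFace,
    downFace, Function.Embedding.coeFn_mk]
  grind

theorem isClosedSurface_T7 : IsClosedSurface T7 := by
  refine ⟨⟨{0, 1, 3}, by decide +kernel⟩, by decide +kernel, ?_, ?_⟩
  · simp only [forall_mem_edges, Finset.insert_subset_iff, Finset.singleton_subset_iff]
    decide +kernel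
  · exact linkConnected_of_chain (hexagonFace 1 2) 5 (by decide +kernel) (by decide +kernel)

theorem isTorus_T7 : IsTorus T7 := by
  refine ⟨isClosedSurface_T7, ?_, ?_, by decide +kernel⟩
  · exact facesConnected_of_chain
      (fun k => if k % 2 = 0
        then ({(k : ZMod 7), (k : ZMod 7) + 1, (k : ZMod 7) + 3} : Finset (ZMod 7))
        else {(k : ZMod 7) - 1, (k : ZMod 7) + 1, (k : ZMod 7) + 2})
      13 (by decide +kernel) (by decide +kernel)
  · exact orientable_of_triples
      (Finset.univ.image (fun i : ZMod 7 => (i, i + 1, i + 3)) ∪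
        Finset.univ.image (fun i : ZMod 7 => (i, i + 3, i + 2)))
      (by decide +kernel) (by decide +kernel)

theorem not_properColoring_T7 (c : ZMod 7 → Fin 3) : ¬ ProperColoring T7 c := by
  intro hc
  have adjacent : ∀ u w : ZMod 7, u ≠ w → {u, w} ∈ edges T7 := by decide +kernel
  have injective : Function.Injective c := fun u w h => by
    by_contra huw
    exact hc _ (adjacent u w huw) u (by simp) w (by simp) huw h
  simpa [ZMod.card] using Fintype.card_le_of_injective c injective

theorem card_of_mem_T21 : ∀ f ∈ T21, f.card = 3 := by
  rw [forall_mem_T21]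
  decide +kernel

theorem card_filter_edge_T21 :
    ∀ e ∈ edges T21, (T21.filter (fun f => e ⊆ f)).card = 2 := by
  simp only [forall_mem_edges, forall_mem_T21, Finset.insert_subset_iff,
    Finset.singleton_subset_iff]
  decide +kernel

theorem linkConnected_T21 : LinkConnected T21 := by
  refine linkConnected_of_chain (hexagonFace 1 16) 5 (by decide +kernel) fun v => ?_
  rw [forall_mem_T21]
  revert v
  decide +kernel

theorem isClosedSurface_T21 : IsClosedSurface T21 :=
  ⟨⟨{0, 1, 17}, by decide +kernel⟩, card_of_mem_T21, card_filter_edge_T21, linkConnected_T21⟩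

theorem properColoring_T21 : ProperColoring T21 (fun v => Fin.ofNat 3 v) := by
  refine properColoring_of_forall_mem ?_
  rw [forall_mem_T21]
  decide +kernel

theorem vertices_T21 : vertices T21 = Finset.univ := by
  decide +kernel

theorem image_mem_T7_of_mem_T21 : ∀ f ∈ T21, f.image (fun w => (w.val : ZMod 7)) ∈ T7 ∧
    (f.image (fun w => (w.val : ZMod 7))).card = 3 := by
  rw [forall_mem_T21]
  decide +kernel

theorem card_filter_lift_T21 :
    ∀ f ∈ T7, (T21.filter (fun g => g.image (fun w => (w.val : ZMod 7)) = f)).card = 3 := by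
  decide +kernel

theorem existsUnique_lift_T21 (v : Fin 21) (f : Finset (ZMod 7)) (hf : f ∈ T7)
    (hv : (v.val : ZMod 7) ∈ f) :
    ∃! g : Finset (Fin 21), g ∈ T21 ∧ v ∈ g ∧ g.image (fun w => (w.val : ZMod 7)) = f := by
  have lifts : ∀ v : Fin 21, ∀ f ∈ T7, (v.val : ZMod 7) ∈ f →
      (T21.filter fun g => v ∈ g ∧ g.image (fun w => (w.val : ZMod 7)) = f).card = 1 := by
    decide +kernel
  obtain ⟨g, hg⟩ := Finset.card_eq_one.mp (lifts v f hf hv)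
  exact ⟨g, by simpa using hg.ge (Finset.mem_singleton_self g),
    fun g' hg' => Finset.mem_singleton.mp (hg.le (Finset.mem_filter.mpr hg'))⟩

/-- The 7-vertex triangulation of the torus has all vertex degrees 6, is not
properly vertex-3-colorable, and admits a properly 3-colorable simplicial
triple cover on 21 vertices. -/
theorem seven_vertex_torus :
    IsTorus T7 ∧ (vertices T7).card = 7 ∧ (∀ v : ZMod 7, degree T7 v = 6) ∧
    (¬ ∃ c : ZMod 7 → Fin 3, ProperColoring T7 c) ∧
    ∃ (F' : Finset (Finset (Fin 21))) (p : Fin 21 → ZMod 7),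
      IsClosedSurface F' ∧ vertices F' = Finset.univ ∧
      -- `p` is simplicial and bijective on each face
      (∀ f ∈ F', f.image p ∈ T7 ∧ (f.image p).card = 3) ∧
      -- `p` is a covering: faces lift uniquely at each vertex
      (∀ v : Fin 21, ∀ f ∈ T7, p v ∈ f →
        ∃! f' : Finset (Fin 21), f' ∈ F' ∧ v ∈ f' ∧ f'.image p = f) ∧
      -- it is a triple cover
      (∀ f ∈ T7, (F'.filter (fun g => g.image p = f)).card = 3) ∧
      -- the cover is properly 3-colorable
      (∃ c : Fin 21 → Fin 3, ProperColoring F' c) := by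
  refine ⟨isTorus_T7, by decide +kernel, by decide +kernel,
    fun ⟨c, hc⟩ => not_properColoring_T7 c hc,
    T21, fun v => (v.val : ZMod 7), isClosedSurface_T21, vertices_T21,
    image_mem_T7_of_mem_T21, existsUnique_lift_T21, card_filter_lift_T21, _, properColoring_T21⟩
end

section
/- Let Σ be a triangulation of a closed d-manifold and τ a (d−3)-simplex such that exactly two (d−2)-simplices σ₁, σ₂ containing τ are odd (incident to an odd number of d-simplices). Then σ₁ and σ₂ are not contained in a common (d−1)-simplex. -/
/-!
Combinatorial triangulated surfaces.

A triangulation is encoded by its finset of faces (each a 3-element finset of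
vertices).  `IsClosedSurface` says: nonempty, every face a triangle, every edge
in exactly two faces, and the faces around each vertex are connected through
edges containing that vertex (so the link of every vertex is a single cycle).
A connected closed surface with Euler characteristic 2 is a sphere, with
Euler characteristic 1 is the projective plane, and an orientable one with
Euler characteristic 0 is the torus.  Surfaces with boundary allow edges lying
in exactly one face; a connected such surface is simply connected iff it is a
disk (Euler characteristic 1, with boundary) or a sphere (Euler characteristic 2).
The degree of a vertex is the number of edges containing it.
-/

namespace Fisk

variable {V : Type*} [DecidableEq V]

/-- Exactness in the middle of a three-term complex of finite-dimensional spaces, by counting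
dimensions. -/
theorem exists_mulVec_eq_of_card_add_card {K I J L : Type*} [Field K] [Fintype I] [Fintype J]
    [Fintype L] (A : Matrix I J K) (B : Matrix J L K) (hAB : A * B = 0)
    (hA : Module.finrank K (LinearMap.ker A.transpose.mulVecLin) ≤ 1)
    (hB : Module.finrank K (LinearMap.ker B.mulVecLin) ≤ 1)
    (hcard : Fintype.card I + Fintype.card L = Fintype.card J + 2)
    (c : J → K) (hc : A.mulVec c = 0) : ∃ s, B.mulVec s = c := by
  classical
  have hrA := A.mulVecLin.finrank_range_add_finrank_ker
  have hrAt := A.transpose.mulVecLin.finrank_range_add_finrank_ker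
  have hrB := B.mulVecLin.finrank_range_add_finrank_ker
  have hrank : Module.finrank K (LinearMap.range A.transpose.mulVecLin) =
      Module.finrank K (LinearMap.range A.mulVecLin) := A.rank_transpose
  simp only [Module.finrank_fintype_fun_eq_card] at hrA hrAt hrB
  have hle : LinearMap.range B.mulVecLin ≤ LinearMap.ker A.mulVecLin := by
    rintro _ ⟨s, rfl⟩
    simp [Matrix.mulVec_mulVec, hAB]
  have heq := Submodule.eq_of_le_of_finrank_le hle (by omega)
  have hmem : c ∈ LinearMap.range B.mulVecLin := by
    rw [heq]
    simpa using hc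
  simpa using hmem

theorem mem_edges_iff {F : Finset (Finset V)} {e : Finset V} :
    e ∈ edges F ↔ ∃ f ∈ F, e ⊆ f ∧ e.card = 2 := by
  simp [edges, Finset.mem_powersetCard]

theorem mem_vertices_iff {F : Finset (Finset V)} {v : V} :
    v ∈ vertices F ↔ ∃ f ∈ F, v ∈ f := by
  simp [vertices, Finset.mem_sup]

theorem filter_edges_subset_eq_powersetCard {F : Finset (Finset V)} {f : Finset V} (hf : f ∈ F) :
    (edges F).filter (fun e => e ⊆ f) = f.powersetCard 2 := by
  ext e
  simp only [Finset.mem_filter, mem_edges_iff, Finset.mem_powersetCard]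
  grind

theorem card_edges_subset_face {F : Finset (Finset V)} {f : Finset V} (hf : f ∈ F)
    (h3 : f.card = 3) : ((edges F).filter (fun e => e ⊆ f)).card = 3 := by
  rw [filter_edges_subset_eq_powersetCard hf, Finset.card_powersetCard, h3]
  rfl

theorem card_edges_through_vertex_subset_face {F : Finset (Finset V)} {f : Finset V} {v : V}
    (hf : f ∈ F) (h3 : f.card = 3) (hv : v ∈ f) :
    ((edges F).filter (fun e => v ∈ e ∧ e ⊆ f)).card = 2 := by
  have himage : (edges F).filter (fun e => v ∈ e ∧ e ⊆ f) =
      (f.erase v).image (fun w => {v, w}) := by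
    ext e
    simp only [Finset.mem_filter, mem_edges_iff, Finset.mem_image, Finset.mem_erase]
    constructor
    · rintro ⟨⟨-, -, -, h2⟩, hve, hef⟩
      obtain ⟨x, y, hxy, rfl⟩ := Finset.card_eq_two.1 h2
      rw [Finset.insert_subset_iff, Finset.singleton_subset_iff] at hef
      rw [Finset.mem_insert, Finset.mem_singleton] at hve
      rcases hve with rfl | rfl
      · exact ⟨y, ⟨hxy.symm, hef.2⟩, rfl⟩
      · exact ⟨x, ⟨hxy, hef.1⟩, Finset.pair_comm _ _⟩
    · rintro ⟨w, ⟨hwv, hwf⟩, rfl⟩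
      have hsub : ({v, w} : Finset V) ⊆ f := by grind
      exact ⟨⟨f, hf, hsub, Finset.card_pair (Ne.symm hwv)⟩, by simp, hsub⟩
  rw [himage, Finset.card_image_of_injOn, Finset.card_erase_of_mem hv, h3]
  intro x hx y hy hxy
  have hx' : x ∈ ({v, y} : Finset V) := by
    rw [← show ({v, x} : Finset V) = {v, y} from hxy]
    simp
  grind

/-- In a closed surface, a vertex lies in as many edges as faces. -/
theorem IsClosedSurface.degree_eq_card_faces {F : Finset (Finset V)} (hF : IsClosedSurface F)
    (v : V) : degree F v = (F.filter (fun f => v ∈ f)).card := by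
  obtain ⟨-, h3, h2, -⟩ := hF
  have hcount := Finset.sum_card_bipartiteAbove_eq_sum_card_bipartiteBelow
    (s := (edges F).filter (fun e => v ∈ e)) (t := F.filter (fun f => v ∈ f))
    (fun e f => e ⊆ f)
  have hleft : ∀ e ∈ (edges F).filter (fun e => v ∈ e),
      (Finset.bipartiteAbove (fun e f => e ⊆ f) (F.filter (fun f => v ∈ f)) e).card = 2 := by
    intro e he
    rw [Finset.mem_filter] at he
    rw [← h2 e he.1]
    congr 1
    ext f
    simp only [Finset.bipartiteAbove, Finset.mem_filter]
    grind
  have hright : ∀ f ∈ F.filter (fun f => v ∈ f),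
      (Finset.bipartiteBelow (fun e f => e ⊆ f) ((edges F).filter (fun e => v ∈ e)) f).card
        = 2 := by
    intro f hf
    rw [Finset.mem_filter] at hf
    rw [← card_edges_through_vertex_subset_face hf.1 (h3 f hf.1) hf.2, Finset.bipartiteBelow,
      Finset.filter_filter]
  rw [Finset.sum_congr rfl hleft, Finset.sum_congr rfl hright] at hcount
  simp only [Finset.sum_const, smul_eq_mul] at hcount
  unfold degree
  omega

/-- The two faces at the common edge of two adjacent faces. -/
theorem IsClosedSurface.filter_inter_subset_eq_pair {F : Finset (Finset V)}
    (hF : IsClosedSurface F) {x y : Finset V} (hx : x ∈ F) (hy : y ∈ F)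
    (hxy : (x ∩ y).card = 2) : x ∩ y ∈ edges F ∧ x ≠ y ∧
      F.filter (fun f => x ∩ y ⊆ f) = {x, y} := by
  have he : x ∩ y ∈ edges F := mem_edges_iff.2 ⟨x, hx, Finset.inter_subset_left, hxy⟩
  have hne : x ≠ y := by
    rintro rfl
    have := hF.2.1 x hx
    rw [Finset.inter_self] at hxy
    omega
  refine ⟨he, hne, (Finset.eq_of_subset_of_card_le ?_ ?_).symm⟩
  · intro f hf
    rw [Finset.mem_insert, Finset.mem_singleton] at hf
    rcases hf with rfl | rfl
    · exact Finset.mem_filter.2 ⟨hx, Finset.inter_subset_left⟩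
    · exact Finset.mem_filter.2 ⟨hy, Finset.inter_subset_right⟩
  · rw [hF.2.2.1 _ he, Finset.card_pair hne]

/-- A function on faces that is preserved by adjacency is constant. -/
theorem FacesConnected.eq_of_adjacent_eq {F : Finset (Finset V)} (hF : FacesConnected F)
    {C : Type*} (s : F → C)
    (hs : ∀ x y : F, ((x : Finset V) ∩ y).card = 2 → s x = s y) (f g : F) : s f = s g := by
  have hchain : ∀ y : Finset V,
      Relation.ReflTransGen (fun x y => x ∈ F ∧ y ∈ F ∧ (x ∩ y).card = 2) (f : Finset V) y →
      ∀ hy : y ∈ F, s f = s ⟨y, hy⟩ := by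
    intro y hy
    induction hy with
    | refl => exact fun _ => rfl
    | tail _ hxy ih => exact fun hy => (ih hxy.1).trans (hs ⟨_, hxy.1⟩ ⟨_, hy⟩ hxy.2.2)
  exact hchain g (hF f f.2 g g.2) g.2

/-- The incidence matrix over `ZMod 2` of vertices against edges. -/
def vertexEdgeMatrix (F : Finset (Finset V)) : Matrix (vertices F) (edges F) (ZMod 2) :=
  fun v e => if (v : V) ∈ (e : Finset V) then 1 else 0

/-- The incidence matrix over `ZMod 2` of edges against faces. -/
def edgeFaceMatrix (F : Finset (Finset V)) : Matrix (edges F) F (ZMod 2) :=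
  fun e f => if (e : Finset V) ⊆ f then 1 else 0

theorem vertexEdgeMatrix_mulVec (F : Finset (Finset V)) (c : Finset V → ZMod 2)
    (v : vertices F) : (vertexEdgeMatrix F).mulVec (fun e => c e) v =
      ∑ e ∈ (edges F).filter (fun e => (v : V) ∈ e), c e := by
  rw [Finset.sum_filter, ← Finset.sum_coe_sort (edges F)]
  simp [Matrix.mulVec, dotProduct, vertexEdgeMatrix, ite_mul]

theorem edgeFaceMatrix_mulVec (F : Finset (Finset V)) (s : Finset V → ZMod 2)
    (e : edges F) : (edgeFaceMatrix F).mulVec (fun f => s f) e =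
      ∑ f ∈ F.filter (fun f => (e : Finset V) ⊆ f), s f := by
  rw [Finset.sum_filter, ← Finset.sum_coe_sort F]
  simp [Matrix.mulVec, dotProduct, edgeFaceMatrix, ite_mul]

theorem vertexEdgeMatrix_mul_edgeFaceMatrix {F : Finset (Finset V)}
    (h3 : ∀ f ∈ F, f.card = 3) : vertexEdgeMatrix F * edgeFaceMatrix F = 0 := by
  ext v f
  have hsum : (vertexEdgeMatrix F * edgeFaceMatrix F) v f =
      (((edges F).filter (fun e => (v : V) ∈ e ∧ e ⊆ (f : Finset V))).card : ZMod 2) := by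
    rw [Matrix.mul_apply, Finset.card_filter, ← Finset.sum_coe_sort (edges F)]
    push_cast
    refine Finset.sum_congr rfl fun e _ => ?_
    simp only [vertexEdgeMatrix, edgeFaceMatrix]
    split_ifs <;> simp_all
  rw [hsum, Matrix.zero_apply]
  by_cases hv : (v : V) ∈ (f : Finset V)
  · rw [card_edges_through_vertex_subset_face f.2 (h3 f f.2) hv]
    rfl
  · rw [Finset.filter_false_of_mem]
    · simp
    · exact fun e _ h => hv (h.2 h.1)

theorem finrank_ker_edgeFaceMatrix_le_one {F : Finset (Finset V)} (hF : IsClosedSurface F)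
    (hconn : FacesConnected F) :
    Module.finrank (ZMod 2) (LinearMap.ker (edgeFaceMatrix F).mulVecLin) ≤ 1 := by
  obtain ⟨f₀, hf₀⟩ := hF.1
  have hconst : ∀ s ∈ LinearMap.ker (edgeFaceMatrix F).mulVecLin, ∀ f g, s f = s g := by
    intro s hs
    refine hconn.eq_of_adjacent_eq s fun x y hxy => ?_
    obtain ⟨he, hne, hpair⟩ := hF.filter_inter_subset_eq_pair x.2 y.2 hxy
    have hzero : (edgeFaceMatrix F).mulVec s ⟨_, he⟩ = 0 := by
      have := LinearMap.mem_ker.1 hs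
      exact congrFun this _
    have hsum := edgeFaceMatrix_mulVec F (fun z => if h : z ∈ F then s ⟨z, h⟩ else 0) ⟨_, he⟩
    simp only [hpair, Finset.sum_pair hne, Finset.coe_mem, dif_pos, Subtype.coe_eta] at hsum
    rw [hzero] at hsum
    exact CharTwo.add_eq_zero.1 hsum.symm
  have hle : LinearMap.ker (edgeFaceMatrix F).mulVecLin ≤
      Submodule.span (ZMod 2) {fun _ => 1} := by
    intro s hs
    rw [Submodule.mem_span_singleton]
    exact ⟨s ⟨f₀, hf₀⟩, funext fun f => by simpa using hconst s hs _ f⟩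
  exact (Submodule.finrank_mono hle).trans ((finrank_span_le_card _).trans (by simp))

theorem finrank_ker_transpose_vertexEdgeMatrix_le_one {F : Finset (Finset V)}
    (hF : IsClosedSurface F) (hconn : FacesConnected F) :
    Module.finrank (ZMod 2) (LinearMap.ker (vertexEdgeMatrix F).transpose.mulVecLin) ≤ 1 := by
  obtain ⟨f₀, hf₀⟩ := hF.1
  have hcard₀ : f₀.card = 3 := hF.2.1 f₀ hf₀
  obtain ⟨v₀, hv₀⟩ : f₀.Nonempty := Finset.card_pos.1 (by omega)
  have hconst : ∀ c ∈ LinearMap.ker (vertexEdgeMatrix F).transpose.mulVecLin,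
      ∀ v w, c v = c w := by
    intro c hc
    set c' : V → ZMod 2 := fun v => if h : v ∈ vertices F then c ⟨v, h⟩ else 0 with hc'
    have hext : ∀ v : vertices F, c v = c' v := fun v => by simp [hc']
    have hedge : ∀ f ∈ F, ∀ v ∈ f, ∀ w ∈ f, c' v = c' w := by
      intro f hf v hv w hw
      by_cases hvw : v = w
      · rw [hvw]
      have he : ({v, w} : Finset V) ∈ edges F :=
        mem_edges_iff.2 ⟨f, hf, by grind, Finset.card_pair hvw⟩
      have hzero : (vertexEdgeMatrix F).transpose.mulVec c ⟨_, he⟩ = 0 :=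
        congrFun (LinearMap.mem_ker.1 hc) _
      have hsum : (vertexEdgeMatrix F).transpose.mulVec c ⟨_, he⟩ =
          ∑ u ∈ (vertices F).filter (fun u => u ∈ ({v, w} : Finset V)), c' u := by
        rw [Finset.sum_filter, ← Finset.sum_coe_sort (vertices F)]
        simp [Matrix.mulVec, dotProduct, vertexEdgeMatrix, ite_mul, hext]
      have hpair : (vertices F).filter (fun u => u ∈ ({v, w} : Finset V)) = {v, w} := by
        ext u
        simp only [Finset.mem_filter, mem_vertices_iff]
        grind
      rw [hsum, hpair, Finset.sum_pair hvw] at hzero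
      exact CharTwo.add_eq_zero.1 hzero
    have hface : ∀ f ∈ F, ∀ v ∈ f, c' v = c' v₀ := by
      have hne : ∀ f : F, (f : Finset V).Nonempty := fun f => by
        have := hF.2.1 f f.2
        exact Finset.card_pos.1 (by omega)
      intro f hf v hv
      have := hconn.eq_of_adjacent_eq (fun f : F => c' (hne f).choose) (fun x y hxy => by
        obtain ⟨u, hu⟩ : ((x : Finset V) ∩ y).Nonempty := Finset.card_pos.1 (by omega)
        rw [Finset.mem_inter] at hu
        exact (hedge x x.2 _ (hne x).choose_spec u hu.1).trans
          (hedge y y.2 u hu.2 _ (hne y).choose_spec)) ⟨f, hf⟩ ⟨f₀, hf₀⟩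
      exact (hedge f hf v hv _ (hne ⟨f, hf⟩).choose_spec).trans
        (this.trans (hedge f₀ hf₀ _ (hne ⟨f₀, hf₀⟩).choose_spec v₀ hv₀))
    intro v w
    obtain ⟨f, hf, hv⟩ := mem_vertices_iff.1 v.2
    obtain ⟨g, hg, hw⟩ := mem_vertices_iff.1 w.2
    rw [hext, hext, hface f hf v hv, hface g hg w hw]
  have hle : LinearMap.ker (vertexEdgeMatrix F).transpose.mulVecLin ≤
      Submodule.span (ZMod 2) {fun _ => 1} := by
    intro c hc
    rw [Submodule.mem_span_singleton]
    exact ⟨c ⟨v₀, mem_vertices_iff.2 ⟨f₀, hf₀, hv₀⟩⟩, funext fun v => by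
      simpa using hconst c hc _ v⟩
  exact (Submodule.finrank_mono hle).trans ((finrank_span_le_card _).trans (by simp))

/-- The first homology of a triangulated 2-sphere with coefficients in `ZMod 2` vanishes. -/
theorem IsSphere.exists_sum_faces_eq {F : Finset (Finset V)} (hF : IsSphere F)
    (c : Finset V → ZMod 2)
    (hc : ∀ v, ∑ e ∈ (edges F).filter (fun e => v ∈ e), c e = 0) :
    ∃ s : Finset V → ZMod 2, ∀ e ∈ edges F, ∑ f ∈ F.filter (fun f => e ⊆ f), s f = c e := by
  obtain ⟨hsurf, hconn, hchar⟩ := hF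
  obtain ⟨s, hs⟩ := exists_mulVec_eq_of_card_add_card (vertexEdgeMatrix F) (edgeFaceMatrix F)
    (vertexEdgeMatrix_mul_edgeFaceMatrix hsurf.2.1)
    (finrank_ker_transpose_vertexEdgeMatrix_le_one hsurf hconn)
    (finrank_ker_edgeFaceMatrix_le_one hsurf hconn)
    (by
      unfold eulerChar at hchar
      simp only [Fintype.card_coe]
      omega)
    (fun e => c e) (funext fun v => by rw [vertexEdgeMatrix_mulVec, hc]; rfl)
  refine ⟨fun z => if h : z ∈ F then s ⟨z, h⟩ else 0, fun e he => ?_⟩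
  rw [← edgeFaceMatrix_mulVec F _ ⟨e, he⟩]
  have := congrFun hs ⟨e, he⟩
  simpa using this

/-- Fisk's theorem: two lone odd-degree vertices of a triangulated 2-sphere are not adjacent. -/
theorem IsSphere.not_isAdjacent_of_odd {F : Finset (Finset V)} (hF : IsSphere F) {a b : V}
    (ha : Odd (degree F a)) (hb : Odd (degree F b))
    (heven : ∀ v, v ≠ a → v ≠ b → Even (degree F v)) : ¬ IsAdjacent F a b := by
  rintro ⟨hab, he⟩
  obtain ⟨s, hs⟩ := hF.exists_sum_faces_eq
    (fun e => 1 + if e = ({a, b} : Finset V) then 1 else 0) (by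
      intro v
      rw [Finset.sum_add_distrib, Finset.sum_const, nsmul_one, Finset.sum_ite_eq']
      change ((degree F v : ℕ) : ZMod 2) + _ = 0
      have hmem : ({a, b} : Finset V) ∈ (edges F).filter (fun e => v ∈ e) ↔ v = a ∨ v = b := by
        simp [he]
      by_cases hv : v = a ∨ v = b
      · rw [if_pos (hmem.2 hv)]
        have hodd : Odd (degree F v) := by rcases hv with rfl | rfl <;> assumption
        rw [(ZMod.natCast_eq_one_iff_odd).2 hodd]
        rfl
      · rw [if_neg (mt hmem.1 hv), (ZMod.natCast_eq_zero_iff_even).2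
          (heven v (fun h => hv (Or.inl h)) (fun h => hv (Or.inr h))), add_zero])
  set t : Finset V → ℤ := fun f => if s f = 0 then 1 else -1 with ht
  have hdouble : ∑ e ∈ edges F, ∑ f ∈ F.filter (fun f => e ⊆ f), t f = 3 * ∑ f ∈ F, t f := by
    simp only [Finset.sum_filter]
    rw [Finset.sum_comm, Finset.mul_sum]
    refine Finset.sum_congr rfl fun f hf => ?_
    rw [← Finset.sum_filter, Finset.sum_const, card_edges_subset_face hf (hF.1.2.1 f hf)]
    simp
  have hedge : ∀ e ∈ edges F, e ≠ ({a, b} : Finset V) →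
      ∑ f ∈ F.filter (fun f => e ⊆ f), t f = 0 := by
    intro e he' hne
    have hsum := hs e he'
    obtain ⟨f, g, hfg, hpair⟩ := Finset.card_eq_two.1 (hF.1.2.2.1 e he')
    rw [hpair, Finset.sum_pair hfg, if_neg hne] at hsum
    rw [hpair, Finset.sum_pair hfg]
    simp only [ht]
    generalize s f = x at *
    generalize s g = y at *
    revert x y
    decide
  rw [Finset.sum_eq_single_of_mem _ he hedge] at hdouble
  have hsum := hs _ he
  obtain ⟨f, g, hfg, hpair⟩ := Finset.card_eq_two.1 (hF.1.2.2.1 _ he)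
  rw [hpair, Finset.sum_pair hfg, if_pos rfl] at hsum
  have hsame : s f = s g := CharTwo.add_eq_zero.1 (hsum.trans (by decide))
  rw [hpair, Finset.sum_pair hfg] at hdouble
  simp only [ht, hsame] at hdouble
  split_ifs at hdouble <;> omega

/-- The faces of a link containing a vertex `v` correspond to the cells containing the join of `v`
with the linked simplex. -/
theorem card_filter_mem_link (cells : Finset (Finset V)) {τ : Finset V} {v : V} (hv : v ∉ τ) :
    (((cells.filter (fun s => τ ⊆ s)).image (fun s => s \ τ)).filter (fun f => v ∈ f)).card =
      (cells.filter (fun s => insert v τ ⊆ s)).card := by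
  have himage : ((cells.filter (fun s => τ ⊆ s)).image (fun s => s \ τ)).filter
      (fun f => v ∈ f) = (cells.filter (fun s => insert v τ ⊆ s)).image (fun s => s \ τ) := by
    ext f
    simp only [Finset.mem_filter, Finset.mem_image, Finset.insert_subset_iff]
    constructor
    · rintro ⟨⟨s, ⟨hs, hτs⟩, rfl⟩, hvs⟩
      exact ⟨s, ⟨hs, (Finset.mem_sdiff.1 hvs).1, hτs⟩, rfl⟩
    · rintro ⟨s, ⟨hs, hvs, hτs⟩, rfl⟩
      exact ⟨⟨s, ⟨hs, hτs⟩, rfl⟩, Finset.mem_sdiff.2 ⟨hvs, hv⟩⟩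
  rw [himage, Finset.card_image_of_injOn]
  intro x hx y hy hxy
  have hτx : τ ⊆ x := (Finset.subset_insert v τ).trans (Finset.mem_filter.1 hx).2
  have hτy : τ ⊆ y := (Finset.subset_insert v τ).trans (Finset.mem_filter.1 hy).2
  rw [← Finset.sdiff_union_of_subset hτx, ← Finset.sdiff_union_of_subset hτy]
  exact congrArg (· ∪ τ) hxy

end Fisk


open Fisk in
/-- If in a triangulated closed `d`-manifold a `(d-3)`-simplex `τ` is
contained in exactly two odd `(d-2)`-simplices `σ₁, σ₂`, then `σ₁` and `σ₂`
are not contained in a common `(d-1)`-simplex.  (The link of a `(d-3)`-simplex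
in a triangulated closed manifold is a triangulated 2-sphere; this hypothesis
is part of the manifold condition.) -/
theorem two_odd_ridges_through_a_face_not_in_common_facet
    {V : Type*} [DecidableEq V]
    (d : ℕ) (hd : 3 ≤ d) (cells : Finset (Finset V))
    (hpure : ∀ s ∈ cells, s.card = d + 1)
    (hridge : ∀ r : Finset V, r.card = d → (∃ s ∈ cells, r ⊆ s) →
      (cells.filter (fun s => r ⊆ s)).card = 2)
    (hlink : ∀ τ : Finset V, τ.card = d - 2 → (∃ s ∈ cells, τ ⊆ s) →
      IsSphere ((cells.filter (fun s => τ ⊆ s)).image (fun s => s \ τ)))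
    (τ : Finset V) (hτ : τ.card = d - 2) (hτs : ∃ s ∈ cells, τ ⊆ s)
    (σ₁ σ₂ : Finset V) (hne : σ₁ ≠ σ₂)
    (h₁ : σ₁.card = d - 1) (h₂ : σ₂.card = d - 1)
    (hτ₁ : τ ⊆ σ₁) (hτ₂ : τ ⊆ σ₂)
    (hodd₁ : Odd (cells.filter (fun s => σ₁ ⊆ s)).card)
    (hodd₂ : Odd (cells.filter (fun s => σ₂ ⊆ s)).card)
    (honly : ∀ σ : Finset V, σ.card = d - 1 → τ ⊆ σ → (∃ s ∈ cells, σ ⊆ s) →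
      Odd (cells.filter (fun s => σ ⊆ s)).card → σ = σ₁ ∨ σ = σ₂) :
    ¬ ∃ ρ : Finset V, ρ.card = d ∧ (∃ s ∈ cells, ρ ⊆ s) ∧
        σ₁ ⊆ ρ ∧ σ₂ ⊆ ρ := by
  rintro ⟨ρ, -, ⟨s, hs, hρs⟩, hσ₁, hσ₂⟩
  have hinsert : ∀ σ : Finset V, σ.card = d - 1 → τ ⊆ σ → ∃ v, v ∉ τ ∧ insert v τ = σ := by
    intro σ hσ hτσ
    obtain ⟨v, hv⟩ := Finset.card_eq_one.1
      (show (σ \ τ).card = 1 by rw [Finset.card_sdiff_of_subset hτσ]; omega)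
    refine ⟨v, (Finset.mem_sdiff.1 (hv ▸ Finset.mem_singleton_self v)).2, ?_⟩
    rw [Finset.insert_eq, ← hv, Finset.sdiff_union_of_subset hτσ]
  obtain ⟨a, ha, rfl⟩ := hinsert σ₁ h₁ hτ₁
  obtain ⟨b, hb, rfl⟩ := hinsert σ₂ h₂ hτ₂
  have hab : a ≠ b := by
    rintro rfl
    exact hne rfl
  have hsphere := hlink τ hτ hτs
  have hdeg := hsphere.1.degree_eq_card_faces
  refine hsphere.not_isAdjacent_of_odd (a := a) (b := b) ?_ ?_ ?_ ⟨hab, ?_⟩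
  · rwa [hdeg, card_filter_mem_link cells ha]
  · rwa [hdeg, card_filter_mem_link cells hb]
  · intro v hva hvb
    rw [hdeg]
    by_cases hv : v ∈ τ
    · rw [Finset.filter_false_of_mem]
      · simp
      · simp only [Finset.mem_image]
        rintro _ ⟨x, -, rfl⟩ hvx
        exact (Finset.mem_sdiff.1 hvx).2 hv
    rw [card_filter_mem_link cells hv, ← Nat.not_odd_iff_even]
    intro hodd
    obtain ⟨x, hx⟩ := Finset.card_pos.1 hodd.pos
    rw [Finset.mem_filter] at hx
    have hmem : v ∈ insert v τ := Finset.mem_insert_self v τ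
    rcases honly (insert v τ) (by rw [Finset.card_insert_of_notMem hv]; omega)
      (Finset.subset_insert v τ) ⟨x, hx⟩ hodd with h | h <;>
    · rw [h, Finset.mem_insert] at hmem
      tauto
  · have has : a ∈ s := hρs (hσ₁ (Finset.mem_insert_self a τ))
    have hbs : b ∈ s := hρs (hσ₂ (Finset.mem_insert_self b τ))
    have hτs' : τ ⊆ s := hτ₁.trans (hσ₁.trans hρs)
    refine mem_edges_iff.2 ⟨s \ τ, Finset.mem_image.2
      ⟨s, Finset.mem_filter.2 ⟨hs, hτs'⟩, rfl⟩, ?_, Finset.card_pair hab⟩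
    simp [Finset.insert_subset_iff, has, hbs, ha, hb]
end
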